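/- arXiv:0909.3667 — 2 statements merged into one kernel-verified Lean document; each statement's English description precedes it below -/
import Mathlib

section
/- Let {B_H(s) : s ≥ 0} be a fractional Brownian motion with Hurst parameter H ∈ (1/2, 1] and let T ∈ W(α, β, γ, C) be a nonnegative random variable independent of {B_H(s)}. Then sup_{s ∈ [0,T]} B_H(s) ∈ W( 2α/(2H + α), β₁, 2γ/(α + 2H), C₂ ), where β₁ = β^{2H/(2H+α)} ( (1/2)(α/H)^{2H/(2H+α)} + (α/H)^{−α/(2H+α)} ) and C₂ = (C√H/√(α+2H)) (H/(αβ))^{γ/(α+2H)}. -/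
open MeasureTheory ProbabilityTheory Filter Set

noncomputable section

/-- A nonnegative random variable `Y` belongs to the asymptotically Weibullian class
`W(a, b, g, c)` if `ℙ(Y > u) = c u^g exp(-b u^a) (1 + o(1))` as `u → ∞`. -/
def MemW {Ω : Type*} [MeasurableSpace Ω] (P : Measure Ω) (Y : Ω → ℝ)
    (a b g c : ℝ) : Prop :=
  Tendsto (fun u : ℝ =>
      (P {ω | u < Y ω}).toReal / (c * u ^ g * Real.exp (-b * u ^ a)))
    atTop (nhds 1)

/-- `X` is a centered Gaussian process (indexed by nonnegative times) with covariance
function `K`. -/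
def IsCenteredGaussianCov {Ω : Type*} [MeasurableSpace Ω] (P : Measure Ω)
    (X : ℝ → Ω → ℝ) (K : ℝ → ℝ → ℝ) : Prop :=
  (∀ t : ℝ, Measurable (X t)) ∧
  ∀ (n : ℕ) (t : Fin n → ℝ) (c : Fin n → ℝ), (∀ i, 0 ≤ t i) →
    ∃ v : NNReal, ((v : ℝ) = ∑ i, ∑ j, c i * c j * K (t i) (t j)) ∧
      Measure.map (fun ω => ∑ i, c i * X (t i) ω) P = gaussianReal 0 v

/-- Covariance function of fractional Brownian motion with Hurst parameter `H`. -/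
def fbmCov (H s t : ℝ) : ℝ := (s ^ (2 * H) + t ^ (2 * H) - |t - s| ^ (2 * H)) / 2

/-- `B` is a fractional Brownian motion with Hurst parameter `H` on `(Ω, P)`:
a centered Gaussian process with the fBm covariance, a.s. continuous sample paths
and `B 0 = 0` a.s. -/
def IsFBM {Ω : Type*} [MeasurableSpace Ω] (P : Measure Ω)
    (H : ℝ) (B : ℝ → Ω → ℝ) : Prop :=
  IsCenteredGaussianCov P B (fbmCov H) ∧
  (∀ᵐ ω ∂P, ContinuousOn (fun t => B t ω) (Set.Ici 0)) ∧
  (∀ᵐ ω ∂P, B 0 ω = 0)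

/-- Upper tail of the standard normal distribution. -/
def normalTail (x : ℝ) : ENNReal := gaussianReal 0 1 (Ioi x)

lemma normalTail_le_one (x : ℝ) : normalTail x ≤ 1 := prob_le_one

lemma gaussianReal_Ici_le {v : NNReal} {V : ℝ} (hv : (v : ℝ) ≤ V) {x : ℝ} (hx : 0 ≤ x) :
    gaussianReal 0 v (Ici x) ≤ ENNReal.ofReal (Real.exp (-x ^ 2 / (2 * V))) := by
  have hV : 0 ≤ V := v.2.trans hv
  have h : HasSubgaussianMGF id ⟨V, hV⟩ (gaussianReal 0 v) := by
    refine ⟨fun t => integrable_exp_mul_gaussianReal t, fun t => ?_⟩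
    rw [mgf_id_gaussianReal]
    apply Real.exp_le_exp.2
    have : (v : ℝ) * t ^ 2 ≤ V * t ^ 2 := by gcongr
    change 0 * t + (v : ℝ) * t ^ 2 / 2 ≤ V * t ^ 2 / 2
    linarith
  have := h.measure_ge_le hx
  rw [← ofReal_measureReal]
  exact ENNReal.ofReal_le_ofReal this

lemma normalTail_le_exp {x : ℝ} (hx : 0 ≤ x) :
    normalTail x ≤ ENNReal.ofReal (Real.exp (-x ^ 2 / 2)) := by
  have := gaussianReal_Ici_le (v := 1) (V := 1) (by simp) hx
  rw [mul_one] at this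
  exact (measure_mono Ioi_subset_Ici_self).trans this

lemma normalTail_le_exp_mul {x y : ℝ} (hx : 0 ≤ x) (hy : 0 ≤ y) :
    normalTail (x - y) ≤ ENNReal.ofReal (Real.exp (x * y - x ^ 2 / 2)) := by
  rcases le_total y x with h | h
  · refine (normalTail_le_exp (sub_nonneg.2 h)).trans ?_
    gcongr
    nlinarith [sq_nonneg y]
  · refine (normalTail_le_one _).trans ?_
    rw [← ENNReal.ofReal_one, ← Real.exp_zero]
    gcongr
    nlinarith

lemma normalTail_eq (x : ℝ) : normalTail x =
    ENNReal.ofReal ((Real.sqrt (2 * Real.pi))⁻¹ * ∫ z in Ioi x, Real.exp (-z ^ 2 / 2)) := by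
  rw [normalTail, gaussianReal_apply_eq_integral 0 one_ne_zero]
  congr 1
  rw [← integral_const_mul]
  simp [gaussianPDFReal]

lemma integrable_exp_neg_sq_half : Integrable fun z : ℝ => Real.exp (-z ^ 2 / 2) := by
  have := integrable_exp_neg_mul_sq (b := 1 / 2) (by norm_num)
  convert this using 3
  ring

lemma mills_integral {x : ℝ} (hx : 0 < x) :
    IntegrableOn (fun z : ℝ => Real.exp (-z ^ 2 / 2) * (1 + (z ^ 2)⁻¹)) (Ioi x) ∧
    ∫ z in Ioi x, Real.exp (-z ^ 2 / 2) * (1 + (z ^ 2)⁻¹) = Real.exp (-x ^ 2 / 2) / x := by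
  have hd : ∀ z ∈ Ici x, HasDerivAt (fun z : ℝ => -(Real.exp (-z ^ 2 / 2) / z))
      (Real.exp (-z ^ 2 / 2) * (1 + (z ^ 2)⁻¹)) z := by
    intro z hz
    have hz0 : z ≠ 0 := (hx.trans_le hz).ne'
    have h1 : HasDerivAt (fun z : ℝ => -z ^ 2 / 2) (-z) z := by
      have := (hasDerivAt_pow 2 z).neg.div_const 2
      refine this.congr_deriv ?_
      push_cast
      ring
    refine (h1.exp.div (hasDerivAt_id' z) hz0).neg.congr_deriv ?_
    field_simp
    ring
  have ht : Tendsto (fun z : ℝ => -(Real.exp (-z ^ 2 / 2) / z)) atTop (nhds 0) := by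
    rw [← neg_zero]
    refine Tendsto.neg ?_
    refine squeeze_zero' (g := fun z : ℝ => z⁻¹) ?_ ?_ tendsto_inv_atTop_zero
    · filter_upwards [eventually_gt_atTop 0] with z hz
      positivity
    · filter_upwards [eventually_gt_atTop 0] with z hz
      rw [div_eq_mul_inv]
      have : Real.exp (-z ^ 2 / 2) ≤ 1 := Real.exp_le_one_iff.2 (by nlinarith [sq_nonneg z])
      have h2 : 0 ≤ z⁻¹ := by positivity
      nlinarith
  have hn : ∀ z ∈ Ioi x, 0 ≤ Real.exp (-z ^ 2 / 2) * (1 + (z ^ 2)⁻¹) := by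
    intro z _
    positivity
  refine ⟨integrableOn_Ioi_deriv_of_nonneg' hd hn ht, ?_⟩
  rw [integral_Ioi_of_hasDerivAt_of_nonneg' hd hn ht]
  ring

lemma normalTail_le_mills {x : ℝ} (hx : 0 < x) :
    normalTail x ≤ ENNReal.ofReal ((Real.sqrt (2 * Real.pi))⁻¹ * (Real.exp (-x ^ 2 / 2) / x)) := by
  rw [normalTail_eq, ← (mills_integral hx).2]
  refine ENNReal.ofReal_le_ofReal (mul_le_mul_of_nonneg_left ?_ (by positivity))
  refine setIntegral_mono_on integrable_exp_neg_sq_half.integrableOn (mills_integral hx).1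
    measurableSet_Ioi fun z _ => ?_
  have : 0 ≤ Real.exp (-z ^ 2 / 2) * (z ^ 2)⁻¹ := by positivity
  linarith

lemma mills_le_normalTail {x : ℝ} (hx : 0 < x) :
    ENNReal.ofReal ((Real.sqrt (2 * Real.pi))⁻¹ * (Real.exp (-x ^ 2 / 2) * x / (x ^ 2 + 1))) ≤
      normalTail x := by
  rw [normalTail_eq]
  gcongr
  have h : Real.exp (-x ^ 2 / 2) / x ≤
      (∫ z in Ioi x, Real.exp (-z ^ 2 / 2)) * (1 + (x ^ 2)⁻¹) := by
    rw [← (mills_integral hx).2, ← integral_mul_const]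
    refine setIntegral_mono_on (mills_integral hx).1
      (integrable_exp_neg_sq_half.mul_const _).integrableOn measurableSet_Ioi fun z hz => ?_
    have hz : x < z := hz
    gcongr
  have hx2 : 0 < 1 + (x ^ 2)⁻¹ := by positivity
  rw [← div_le_iff₀ hx2] at h
  refine le_of_eq_of_le ?_ h
  field_simp

lemma exp_le_mul_normalTail {x : ℝ} (hx : 1 ≤ x) :
    ENNReal.ofReal (Real.exp (-x ^ 2 / 2)) ≤ ENNReal.ofReal (6 * x) * normalTail x := by
  have hx0 : 0 < x := by linarith
  refine le_trans ?_ (mul_le_mul_right (mills_le_normalTail hx0) _)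
  rw [← ENNReal.ofReal_mul (by positivity)]
  apply ENNReal.ofReal_le_ofReal
  have hs : Real.sqrt (2 * Real.pi) ≤ 3 := by
    rw [Real.sqrt_le_iff]
    have := Real.pi_lt_d2
    constructor <;> linarith
  have hs0 : 0 < Real.sqrt (2 * Real.pi) := by positivity
  have e : 6 * x * ((Real.sqrt (2 * Real.pi))⁻¹ * (Real.exp (-x ^ 2 / 2) * x / (x ^ 2 + 1)))
    = Real.exp (-x ^ 2 / 2) * (6 * x ^ 2 / (Real.sqrt (2 * Real.pi) * (x ^ 2 + 1))) := by
    field_simp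
  rw [e]
  apply le_mul_of_one_le_right (Real.exp_pos _).le
  rw [one_le_div (by positivity)]
  nlinarith

lemma normalTail_sub_le {x y : ℝ} (hx : 1 ≤ x) (hy : 0 ≤ y) :
    normalTail (x - y) ≤ ENNReal.ofReal (6 * Real.exp (3 * (x * y))) * normalTail x := by
  have hx0 : 0 < x := by linarith
  rcases le_total y (x / 2) with h | h
  · refine le_trans (normalTail_le_mills (by linarith)) ?_
    refine le_trans ?_ (mul_le_mul_right (mills_le_normalTail hx0) _)
    rw [← ENNReal.ofReal_mul (by positivity)]
    apply ENNReal.ofReal_le_ofReal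
    rw [mul_left_comm]
    gcongr
    have h1 : Real.exp (-(x - y) ^ 2 / 2) ≤ Real.exp (3 * (x * y)) * Real.exp (-x ^ 2 / 2) := by
      rw [← Real.exp_add]
      gcongr
      nlinarith [mul_nonneg hx0.le hy, sq_nonneg y]
    rw [div_le_iff₀ (by linarith)]
    refine h1.trans ?_
    have e : 6 * Real.exp (3 * (x * y)) * (Real.exp (-x ^ 2 / 2) * x / (x ^ 2 + 1)) * (x - y)
      = Real.exp (3 * (x * y)) * Real.exp (-x ^ 2 / 2) * (6 * x * (x - y) / (x ^ 2 + 1)) := by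
      field_simp
    rw [e]
    apply le_mul_of_one_le_right (by positivity)
    rw [one_le_div (by positivity)]
    nlinarith
  · refine (normalTail_le_exp_mul hx0.le hy).trans ?_
    have h1 : ENNReal.ofReal (Real.exp (x * y - x ^ 2 / 2)) =
        ENNReal.ofReal (Real.exp (x * y)) * ENNReal.ofReal (Real.exp (-x ^ 2 / 2)) := by
      rw [← ENNReal.ofReal_mul (by positivity), ← Real.exp_add]
      congr 2
      ring
    rw [h1]
    refine (mul_le_mul_right (exp_le_mul_normalTail hx) _).trans ?_
    rw [← mul_assoc, ← ENNReal.ofReal_mul (by positivity)]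
    refine mul_le_mul_left (ENNReal.ofReal_le_ofReal ?_) _
    have h2 : x ≤ Real.exp (2 * (x * y)) := by
      have := Real.add_one_le_exp (2 * (x * y))
      nlinarith
    have h3 : Real.exp (3 * (x * y)) = Real.exp (x * y) * Real.exp (2 * (x * y)) := by
      rw [← Real.exp_add]
      ring_nf
    rw [h3]
    have := Real.exp_pos (x * y)
    nlinarith

lemma normalTail_sub_div_le {ε : ℝ} (hε : 0 < ε) :
    ∃ x₀ : ℝ, 1 ≤ x₀ ∧ ∀ x, x₀ ≤ x →
      normalTail (x - ε / x) ≤ ENNReal.ofReal (Real.exp (2 * ε)) * normalTail x := by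
  refine ⟨1 + (1 + ε + ε ^ 2) / ε, by simp; positivity, fun x hx => ?_⟩
  have h0 : 0 < (1 + ε + ε ^ 2) / ε := by positivity
  have hx1 : 1 ≤ x := by linarith
  have hx0 : 0 < x := by linarith
  have h1 : 1 + ε + ε ^ 2 ≤ ε * x := by
    have : (1 + ε + ε ^ 2) / ε ≤ x := by linarith
    rwa [div_le_iff₀ hε, mul_comm] at this
  have h2 : 1 + ε + ε ^ 2 ≤ ε * x ^ 2 := by nlinarith [mul_pos hε hx0]
  have h3 : ε < x ^ 2 := by nlinarith
  have h4 : x - ε / x = (x ^ 2 - ε) / x := by field_simp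
  have h5 : 0 < x - ε / x := by rw [h4]; exact div_pos (by linarith) hx0
  refine le_trans (normalTail_le_mills h5) ?_
  refine le_trans ?_ (mul_le_mul_right (mills_le_normalTail hx0) _)
  rw [← ENNReal.ofReal_mul (by positivity)]
  apply ENNReal.ofReal_le_ofReal
  rw [mul_left_comm]
  gcongr
  have h6 : Real.exp (-(x - ε / x) ^ 2 / 2) ≤ Real.exp ε * Real.exp (-x ^ 2 / 2) := by
    rw [← Real.exp_add]
    gcongr
    have : (x - ε / x) ^ 2 = x ^ 2 - 2 * ε + (ε / x) ^ 2 := by field_simp; ring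
    rw [this]
    nlinarith [sq_nonneg (ε / x)]
  have h7 : Real.exp (2 * ε) = Real.exp ε * Real.exp ε := by rw [← Real.exp_add]; ring_nf
  rw [div_le_iff₀ h5]
  refine h6.trans ?_
  rw [h4, h7]
  have e : Real.exp ε * Real.exp ε * (Real.exp (-x ^ 2 / 2) * x / (x ^ 2 + 1)) * ((x ^ 2 - ε) / x)
    = Real.exp ε * Real.exp (-x ^ 2 / 2) * (Real.exp ε * (x ^ 2 - ε) / (x ^ 2 + 1)) := by
    field_simp
  rw [e]
  apply le_mul_of_one_le_right (by positivity)
  rw [one_le_div (by positivity)]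
  have := Real.add_one_le_exp ε
  nlinarith

lemma ENNReal.tsum_ofReal_exp_neg_succ {a : ℝ} (ha : Real.log 2 ≤ a) :
    ∑' n : ℕ, ENNReal.ofReal (Real.exp (-((n + 1 : ℕ) * a))) ≤
      ENNReal.ofReal (2 * Real.exp (-a)) := by
  have ha0 : 0 < a := (Real.log_pos (by norm_num)).trans_le ha
  have h1 : Real.exp (-a) ≤ 1 / 2 := by
    have : Real.exp (-a) ≤ Real.exp (-Real.log 2) := by gcongr
    rwa [Real.exp_neg (Real.log 2), Real.exp_log (by norm_num), ← one_div] at this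
  have h2 : ∀ n : ℕ, Real.exp (-((n + 1 : ℕ) * a)) = Real.exp (-a) * Real.exp (-a) ^ n := by
    intro n
    rw [← Real.exp_nat_mul, ← Real.exp_add]
    congr 1
    push_cast
    ring
  simp_rw [h2]
  rw [← ENNReal.ofReal_tsum_of_nonneg (fun n => by positivity)
    ((summable_geometric_of_lt_one (Real.exp_pos _).le (by linarith)).mul_left _), tsum_mul_left,
    tsum_geometric_of_lt_one (Real.exp_pos _).le (by linarith), mul_comm]
  gcongr
  rw [inv_le_comm₀ (by linarith) (by norm_num)]
  linarith

lemma tsum_exp_le_normalTail {κ η : ℝ} (hκ : 0 < κ) (hη : 0 < η) :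
    ∃ x₀ : ℝ, ∀ x, x₀ ≤ x →
      ∑' n : ℕ, ENNReal.ofReal (Real.exp (-((1 + (n + 1 : ℕ) * κ) * x ^ 2 / 2))) ≤
        ENNReal.ofReal η * normalTail x := by
  have hlim : Tendsto (fun x : ℝ => 12 * (x ^ (1 : ℕ) * Real.exp (-(κ / 2) * x))) atTop
      (nhds 0) := by
    rw [← mul_zero (12 : ℝ)]
    refine Tendsto.const_mul 12 ?_
    simpa using tendsto_rpow_mul_exp_neg_mul_atTop_nhds_zero 1 (κ / 2) (by positivity)
  obtain ⟨x₁, h₁⟩ := eventually_atTop.1 (hlim.eventually (gt_mem_nhds hη))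
  obtain ⟨x₂, h₂⟩ := eventually_atTop.1 (eventually_ge_atTop (Real.log 2 * 2 / κ))
  refine ⟨max 1 (max x₁ x₂), fun x hx => ?_⟩
  simp only [max_le_iff] at hx
  obtain ⟨hx1, hx₁, hx₂⟩ := hx
  have ha : Real.log 2 ≤ κ * x ^ 2 / 2 := by
    have := h₂ x hx₂
    rw [div_le_iff₀ hκ] at this
    nlinarith [mul_nonneg hκ.le (mul_nonneg (by linarith : 0 ≤ x) (sub_nonneg.2 hx1))]
  have h3 : ∀ n : ℕ, ENNReal.ofReal (Real.exp (-((1 + (n + 1 : ℕ) * κ) * x ^ 2 / 2))) =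
      ENNReal.ofReal (Real.exp (-x ^ 2 / 2)) *
        ENNReal.ofReal (Real.exp (-((n + 1 : ℕ) * (κ * x ^ 2 / 2)))) := by
    intro n
    rw [← ENNReal.ofReal_mul (by positivity), ← Real.exp_add]
    congr 2
    ring
  simp_rw [h3]
  rw [ENNReal.tsum_mul_left]
  refine (mul_le_mul' (exp_le_mul_normalTail hx1) (ENNReal.tsum_ofReal_exp_neg_succ ha)).trans ?_
  rw [mul_right_comm, ← ENNReal.ofReal_mul (by linarith)]
  gcongr
  refine le_trans ?_ (h₁ x hx₁).le
  have : Real.exp (-(κ * x ^ 2 / 2)) ≤ Real.exp (-(κ / 2) * x) := by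
    gcongr
    nlinarith [mul_nonneg hκ.le (mul_nonneg (by linarith : 0 ≤ x) (sub_nonneg.2 hx1))]
  rw [pow_one]
  nlinarith

section

lemma natFloor_two_mul_eq {x : ℝ} (hx : 0 ≤ x) :
    ⌊2 * x⌋₊ = 2 * ⌊x⌋₊ ∨ ⌊2 * x⌋₊ = 2 * ⌊x⌋₊ + 1 := by
  have h1 := Nat.floor_le hx
  have h2 := Nat.lt_floor_add_one x
  have h3 : 2 * ⌊x⌋₊ ≤ ⌊2 * x⌋₊ := Nat.le_floor (by push_cast; linarith)
  have h4 : ⌊2 * x⌋₊ < 2 * ⌊x⌋₊ + 2 := (Nat.floor_lt (by linarith)).2 (by push_cast; linarith)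
  omega

lemma sqrt_half_bounds : 0.7 < √(1 / 2 : ℝ) ∧ √(1 / 2 : ℝ) < 0.708 := by
  constructor
  · rw [Real.lt_sqrt] <;> norm_num
  · rw [Real.sqrt_lt'] <;> norm_num

/-- A continuous function whose dyadic increments of every level `n ≥ m₀` are at most
`a 2^{-n/2}` grows at most like a multiple of the square root near `0`. -/
lemma le_sqrt_of_dyadic_increments {f : ℝ → ℝ} {a : ℝ} {m₀ : ℕ} (ha : 0 ≤ a)
    (hf : ContinuousOn f (Icc 0 1)) (hf0 : f 0 ≤ 0)
    (hinc : ∀ n, m₀ ≤ n → ∀ j < 2 ^ n,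
      f ((j + 1 : ℕ) / 2 ^ n) ≤ f ((j : ℕ) / 2 ^ n) + a * √(1 / 2 : ℝ) ^ n)
    {r : ℝ} (hr0 : 0 ≤ r) (hr : r ≤ (1 / 2) ^ m₀) : f r ≤ 6 * a * √r := by
  obtain ⟨hw1, hw2⟩ := sqrt_half_bounds
  set w := √(1 / 2 : ℝ) with hw
  have hw0 : 0 < w := by linarith
  rcases hr0.eq_or_lt with rfl | hrpos
  · simpa using hf0
  have hr1 : r ≤ 1 := hr.trans (pow_le_one₀ (by norm_num) (by norm_num))
  obtain ⟨m, hm1, hm2⟩ := exists_nat_pow_near_of_lt_one hrpos hr1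
    (by norm_num : (0 : ℝ) < 1 / 2) (by norm_num)
  have hm : m₀ ≤ m := by
    have := hm1.trans_le hr
    rw [pow_lt_pow_iff_right_of_lt_one₀ (by norm_num) (by norm_num)] at this
    omega
  have hpow : ∀ n : ℕ, (0 : ℝ) < 2 ^ n := fun n => by positivity
  have key : ∀ k : ℕ, f ((⌊r * 2 ^ (m + k)⌋₊ : ℕ) / 2 ^ (m + k)) ≤
      a * (3.5 * w ^ m - 2.5 * w ^ (m + k)) := by
    intro k
    induction k with
    | zero =>
      rw [add_zero]
      have h1 : r * 2 ^ m ≤ 1 := by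
        rw [one_div, inv_pow] at hm2
        calc r * 2 ^ m ≤ (2 ^ m)⁻¹ * 2 ^ m := by gcongr
          _ = 1 := inv_mul_cancel₀ (hpow m).ne'
      have h2 : ⌊r * 2 ^ m⌋₊ ≤ 1 := Nat.floor_le_of_le (by simpa using h1)
      have h3 : 0 ≤ a * w ^ m := by positivity
      have h4 := hinc m hm 0 (by positivity)
      simp only [zero_add, Nat.cast_one, Nat.cast_zero, zero_div] at h4
      interval_cases hj : ⌊r * 2 ^ m⌋₊
      · simp only [Nat.cast_zero, zero_div]
        linarith
      · simp only [Nat.cast_one]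
        linarith
    | succ k ih =>
      have h0 : r * 2 ^ (m + (k + 1)) = 2 * (r * 2 ^ (m + k)) := by
        rw [← add_assoc, pow_succ]; ring
      have h5 : a * (3.5 * w ^ m - 2.5 * w ^ (m + k)) + a * w ^ (m + (k + 1)) ≤
          a * (3.5 * w ^ m - 2.5 * w ^ (m + (k + 1))) := by
        rw [← mul_add]
        gcongr
        rw [← add_assoc, pow_succ]
        have : 0 < w ^ (m + k) := by positivity
        nlinarith
      have h7 : 0 ≤ a * w ^ (m + (k + 1)) := by positivity
      have h6 : ((2 * ⌊r * 2 ^ (m + k)⌋₊ : ℕ) : ℝ) / 2 ^ (m + (k + 1)) =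
          (⌊r * 2 ^ (m + k)⌋₊ : ℕ) / 2 ^ (m + k) := by
        rw [← add_assoc, pow_succ]
        push_cast
        field_simp
      rcases natFloor_two_mul_eq (x := r * 2 ^ (m + k)) (by positivity) with h | h
      · rw [h0, h, h6]
        linarith
      · have h8 : 2 * ⌊r * 2 ^ (m + k)⌋₊ < 2 ^ (m + (k + 1)) := by
          have : 2 * ⌊r * 2 ^ (m + k)⌋₊ + 1 ≤ 2 ^ (m + (k + 1)) := by
            rw [← h, ← h0]
            apply Nat.floor_le_of_le
            push_cast
            exact mul_le_of_le_one_left (hpow _).le hr1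
          omega
        have h9 := hinc (m + (k + 1)) (by omega) _ h8
        rw [h6] at h9
        rw [h0, h]
        linarith
  have hlim : Tendsto (fun k : ℕ => ((⌊r * 2 ^ (m + k)⌋₊ : ℕ) : ℝ) / 2 ^ (m + k)) atTop
      (nhds r) := by
    refine (tendsto_nat_floor_mul_div_atTop hr0).comp (g := fun x : ℝ => (⌊r * x⌋₊ : ℝ) / x) ?_
    exact (tendsto_pow_atTop_atTop_of_one_lt (by norm_num : (1 : ℝ) < 2)).comp
      (tendsto_atTop_mono (fun k => Nat.le_add_left k m) tendsto_id)
  have hmem : ∀ k : ℕ, ((⌊r * 2 ^ (m + k)⌋₊ : ℕ) : ℝ) / 2 ^ (m + k) ∈ Icc (0 : ℝ) 1 := by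
    intro k
    refine ⟨by positivity, ?_⟩
    rw [div_le_one (hpow _)]
    exact (Nat.floor_le (by positivity)).trans (mul_le_of_le_one_left (hpow _).le hr1)
  have hlim2 := ((hf r ⟨hr0, hr1⟩).tendsto).comp
    (tendsto_nhdsWithin_of_tendsto_nhds_of_eventually_within _ hlim (Eventually.of_forall hmem))
  have h10 : f r ≤ a * (3.5 * w ^ m) := by
    refine le_of_tendsto hlim2 (Eventually.of_forall fun k => (key k).trans ?_)
    gcongr
    have : 0 < w ^ (m + k) := by positivity
    linarith
  have h11 : w ^ (m + 1) ≤ √r := by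
    apply Real.le_sqrt_of_sq_le
    rw [← pow_mul, mul_comm, pow_mul, hw, Real.sq_sqrt (by norm_num)]
    exact hm1.le
  rw [pow_succ] at h11
  have h12 : w ^ m ≤ √r / 0.7 := by
    rw [le_div_iff₀ (by norm_num)]
    refine le_trans ?_ h11
    gcongr
  calc f r ≤ a * (3.5 * w ^ m) := h10
    _ ≤ a * (3.5 * (√r / 0.7)) := by gcongr
    _ ≤ 6 * a * √r := by
      have : 0 ≤ a * √r := by positivity
      have h13 : a * (3.5 * (√r / 0.7)) = 5 * (a * √r) := by ring
      linarith

variable {Ω : Type*} [MeasurableSpace Ω]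

lemma charFun_map_toLp_prod {P : Measure Ω} {X Y : Ω → ℝ} (hX : Measurable X) (hY : Measurable Y)
    (t : WithLp 2 (ℝ × ℝ)) :
    charFun (P.map (fun ω => WithLp.toLp 2 (X ω, Y ω))) t =
      charFun (P.map (fun ω => t.ofLp.1 * X ω + t.ofLp.2 * Y ω)) 1 := by
  rw [charFun_apply, charFun_apply, integral_map (by fun_prop) (by fun_prop),
    integral_map (by fun_prop) (by fun_prop)]
  simp [mul_comm]

/-- Uncorrelated jointly Gaussian real random variables are independent. -/
lemma indepFun_of_map_combination {P : Measure Ω} [IsProbabilityMeasure P] {X Y : Ω → ℝ}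
    (hX : Measurable X) (hY : Measurable Y) {a b : ℝ}
    (h : ∀ p q : ℝ, ∃ v : NNReal, (v : ℝ) = p ^ 2 * a + q ^ 2 * b ∧
      P.map (fun ω => p * X ω + q * Y ω) = gaussianReal 0 v) : IndepFun X Y P := by
  rw [indepFun_iff_charFun_prod hX.aemeasurable hY.aemeasurable]
  intro t
  rw [charFun_map_toLp_prod hX hY]
  obtain ⟨v, hv, hlaw⟩ := h t.ofLp.1 t.ofLp.2
  obtain ⟨v₁, hv₁, hlaw₁⟩ := h 1 0
  obtain ⟨v₂, hv₂, hlaw₂⟩ := h 0 1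
  simp only [one_mul, zero_mul, add_zero, zero_add] at hlaw₁ hlaw₂
  rw [hlaw, hlaw₁, hlaw₂]
  simp only [charFun_gaussianReal]
  rw [← Complex.exp_add]
  congr 1
  have hv' : ((v : ℝ) : ℂ) = ((t.ofLp.1 ^ 2 * a + t.ofLp.2 ^ 2 * b : ℝ) : ℂ) := by rw [hv]
  have hv₁' : ((v₁ : ℝ) : ℂ) = ((1 ^ 2 * a + 0 ^ 2 * b : ℝ) : ℂ) := by rw [hv₁]
  have hv₂' : ((v₂ : ℝ) : ℂ) = ((0 ^ 2 * a + 1 ^ 2 * b : ℝ) : ℂ) := by rw [hv₂]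
  rw [hv', hv₁', hv₂']
  push_cast
  ring

lemma fbmCov_self {H t : ℝ} (hH : 0 < H) : fbmCov H t t = t ^ (2 * H) := by
  rw [fbmCov, sub_self, abs_zero, Real.zero_rpow (by positivity)]
  ring

lemma fbmCov_comm (H s t : ℝ) : fbmCov H s t = fbmCov H t s := by
  rw [fbmCov, fbmCov, abs_sub_comm, add_comm (s ^ _)]

lemma IsFBM.measurable {P : Measure Ω} {H : ℝ} {B : ℝ → Ω → ℝ} (hB : IsFBM P H B) (t : ℝ) :
    Measurable (B t) := hB.1.1 t

/-- The increment of the fBm over `[s, t]`, with its regression on `B 1` removed. -/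
def regressedIncrement (H : ℝ) (B : ℝ → Ω → ℝ) (s t : ℝ) (ω : Ω) : ℝ :=
  (B s ω - fbmCov H s 1 * B 1 ω) - (B t ω - fbmCov H t 1 * B 1 ω)

lemma IsFBM.law_regressedIncrement_add {P : Measure Ω} {H : ℝ} (hH : 0 < H) {B : ℝ → Ω → ℝ}
    (hB : IsFBM P H B) {s t : ℝ} (hs : 0 ≤ s) (ht : 0 ≤ t) (p q : ℝ) :
    ∃ v : NNReal, (v : ℝ) =
      p ^ 2 * (|t - s| ^ (2 * H) - (fbmCov H s 1 - fbmCov H t 1) ^ 2) + q ^ 2 * 1 ∧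
      P.map (fun ω => p * regressedIncrement H B s t ω + q * B 1 ω) = gaussianReal 0 v := by
  obtain ⟨v, hv, hlaw⟩ := hB.1.2 3 ![s, t, 1]
    ![p, -p, -p * (fbmCov H s 1 - fbmCov H t 1) + q] (by
      intro i
      fin_cases i <;> simp [hs, ht])
  refine ⟨v, ?_, ?_⟩
  · rw [hv]
    simp only [Fin.sum_univ_three, Matrix.cons_val_zero, Matrix.cons_val_one, Matrix.cons_val]
    rw [fbmCov_self hH, fbmCov_self hH, fbmCov_self hH, fbmCov_comm H t s, fbmCov_comm H 1 s,
      fbmCov_comm H 1 t, Real.one_rpow]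
    have : fbmCov H s t = (s ^ (2 * H) + t ^ (2 * H) - |t - s| ^ (2 * H)) / 2 := rfl
    rw [this]
    ring
  · rw [← hlaw]
    congr 1
    ext ω
    simp only [Fin.sum_univ_three, Matrix.cons_val_zero, Matrix.cons_val_one, Matrix.cons_val,
      regressedIncrement]
    ring

lemma IsFBM.measurable_regressedIncrement {P : Measure Ω} {H : ℝ} {B : ℝ → Ω → ℝ}
    (hB : IsFBM P H B) (s t : ℝ) : Measurable (regressedIncrement H B s t) := by
  have := hB.measurable
  unfold regressedIncrement
  fun_prop

lemma IsFBM.map_eq {P : Measure Ω} {H : ℝ} (hH : 0 < H) {B : ℝ → Ω → ℝ} (hB : IsFBM P H B)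
    {t : ℝ} (ht : 0 ≤ t) : P.map (B t) = gaussianReal 0 (t ^ (2 * H)).toNNReal := by
  obtain ⟨v, hv, hlaw⟩ := hB.1.2 1 ![t] ![1] (by simpa using ht)
  simp only [Fin.sum_univ_one, Matrix.cons_val_fin_one, one_mul, fbmCov_self hH] at hv hlaw
  rw [← hv, Real.toNNReal_coe]
  exact hlaw

lemma IsFBM.measure_one_gt {P : Measure Ω} {H : ℝ} (hH : 0 < H) {B : ℝ → Ω → ℝ}
    (hB : IsFBM P H B) (x : ℝ) : P {ω | x < B 1 ω} = normalTail x := by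
  have := hB.map_eq hH zero_le_one
  rw [Real.one_rpow, Real.toNNReal_one] at this
  rw [normalTail, ← this, Measure.map_apply (hB.measurable 1) measurableSet_Ioi]
  rfl

lemma IsFBM.measure_one_gt_inter_le {P : Measure Ω} [IsProbabilityMeasure P] {H : ℝ} (hH : 0 < H)
    {B : ℝ → Ω → ℝ} (hB : IsFBM P H B) {s t : ℝ} (hs : 0 ≤ s) (ht : 0 ≤ t) (x : ℝ) {b : ℝ}
    (hb : 0 ≤ b) :
    P ({ω | x < B 1 ω} ∩ {ω | b < regressedIncrement H B s t ω}) ≤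
      normalTail x * ENNReal.ofReal (Real.exp (-b ^ 2 / (2 * |t - s| ^ (2 * H)))) := by
  have hind : IndepFun (B 1) (regressedIncrement H B s t) P :=
    (indepFun_of_map_combination (hB.measurable_regressedIncrement s t) (hB.measurable 1)
      (hB.law_regressedIncrement_add hH hs ht)).symm
  have h1 := hind.measure_inter_preimage_eq_mul _ _ (measurableSet_Ioi (a := x))
    (measurableSet_Ioi (a := b))
  change P ((B 1) ⁻¹' Ioi x ∩ (regressedIncrement H B s t) ⁻¹' Ioi b) ≤ _
  rw [h1]
  have h2 : P (B 1 ⁻¹' Ioi x) = normalTail x := hB.measure_one_gt hH x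
  rw [h2]
  gcongr
  obtain ⟨v, hv, hlaw⟩ := hB.law_regressedIncrement_add hH hs ht 1 0
  simp only [one_mul, zero_mul, add_zero] at hlaw
  rw [← Measure.map_apply (hB.measurable_regressedIncrement s t) measurableSet_Ioi, hlaw]
  refine (measure_mono Ioi_subset_Ici_self).trans (gaussianReal_Ici_le ?_ hb)
  rw [hv]
  nlinarith [sq_nonneg (fbmCov H s 1 - fbmCov H t 1)]

end

section

lemma fbmCov_one_bounds {H s : ℝ} (hH : 1 / 2 < H) (hs : 1 / 2 ≤ s) (hs1 : s ≤ 1) :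
    1 / 2 ≤ fbmCov H s 1 ∧ fbmCov H s 1 ≤ 1 - (1 - s) / 2 := by
  have h1 : |1 - s| = 1 - s := abs_of_nonneg (by linarith)
  have h2 : (1 - s) ^ (2 * H) ≤ s ^ (2 * H) := by
    apply Real.rpow_le_rpow <;> linarith
  have h3 : s ^ (2 * H) ≤ s := by
    conv_rhs => rw [← Real.rpow_one s]
    apply Real.rpow_le_rpow_of_exponent_ge <;> linarith
  have h4 : 0 ≤ (1 - s) ^ (2 * H) := Real.rpow_nonneg (by linarith) _
  rw [fbmCov, h1, Real.one_rpow]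
  constructor <;> linarith

lemma continuous_fbmCov_right {H : ℝ} (hH : 0 < H) : Continuous fun r : ℝ => fbmCov H (1 - r) 1 := by
  unfold fbmCov
  have h : 0 ≤ 2 * H := by positivity
  have h1 : Continuous fun r : ℝ => (1 - r) ^ (2 * H) :=
    (continuous_const.sub continuous_id).rpow_const fun _ => Or.inr h
  have h2 : Continuous fun r : ℝ => |1 - (1 - r)| ^ (2 * H) :=
    (by fun_prop : Continuous fun r : ℝ => |1 - (1 - r)|).rpow_const fun _ => Or.inr h
  fun_prop

/-- If a path exceeds `x` near time `1` while its value at time `1` is below `x - ε / x`, then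
some dyadic increment of the path regressed on its terminal value is large. -/
lemma exists_large_regressedIncrement {Ω : Type*} {H : ℝ} (hH : 1 / 2 < H) {B : ℝ → Ω → ℝ} {ω : Ω}
    (hcont : ContinuousOn (fun t => B t ω) (Ici 0)) {m₀ : ℕ} (hm₀ : 1 ≤ m₀) {ε x : ℝ}
    (hε : 0 < ε) (hx : 0 < x) (hN : B 1 ω ≤ x - ε / x)
    {s : ℝ} (hs : 1 - (1 / 2) ^ m₀ ≤ s) (hs1 : s ≤ 1) (hsx : x < B s ω) :
    ∃ k n : ℕ, ∃ j < 2 ^ (n + m₀), x - (k + 2 : ℕ) * ε / x < B 1 ω ∧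
      √((k + 1 : ℕ) * ε) / 6 * √(1 / 2 : ℝ) ^ (n + m₀) <
        regressedIncrement H B (1 - (j + 1 : ℕ) / 2 ^ (n + m₀)) (1 - (j : ℕ) / 2 ^ (n + m₀)) ω := by
  have hq1 : 1 ≤ (x - B 1 ω) * x / ε := by
    rw [one_le_div hε, ← div_le_iff₀ hx]
    linarith
  obtain ⟨k, hk⟩ := Nat.exists_eq_add_of_le' (Nat.one_le_floor_iff _ |>.2 hq1)
  have hk1 : ((k + 1 : ℕ) : ℝ) ≤ (x - B 1 ω) * x / ε := by
    rw [← hk]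
    exact Nat.floor_le (by linarith)
  have hk2 : (x - B 1 ω) * x / ε < (k + 2 : ℕ) := by
    have := Nat.lt_floor_add_one ((x - B 1 ω) * x / ε)
    rw [hk] at this
    push_cast at this ⊢
    linarith
  rw [le_div_iff₀ hε] at hk1
  rw [div_lt_iff₀ hε] at hk2
  by_contra! hcon
  have hinc : ∀ n, m₀ ≤ n → ∀ j < 2 ^ n,
      (fun r => B (1 - r) ω - fbmCov H (1 - r) 1 * B 1 ω) ((j + 1 : ℕ) / 2 ^ n) ≤
      (fun r => B (1 - r) ω - fbmCov H (1 - r) 1 * B 1 ω) ((j : ℕ) / 2 ^ n) +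
        √((k + 1 : ℕ) * ε) / 6 * √(1 / 2 : ℝ) ^ n := by
    intro n hn j hj
    obtain ⟨i, rfl⟩ := Nat.exists_eq_add_of_le' hn
    have := hcon k i j hj (by
      rw [sub_lt_comm, lt_div_iff₀ hx]
      exact hk2)
    rw [regressedIncrement] at this
    dsimp only
    linarith
  have hcontf : ContinuousOn (fun r => B (1 - r) ω - fbmCov H (1 - r) 1 * B 1 ω) (Icc 0 1) := by
    refine ContinuousOn.sub ?_
      (((continuous_fbmCov_right (by linarith)).mul continuous_const).continuousOn)
    exact hcont.comp (by fun_prop) fun r hr => by simpa using hr.2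
  have hf0 : (fun r => B (1 - r) ω - fbmCov H (1 - r) 1 * B 1 ω) 0 ≤ 0 := by
    simp [fbmCov_self (by linarith : 0 < H)]
  have hr := le_sqrt_of_dyadic_increments (by positivity) hcontf hf0 hinc (r := 1 - s)
    (by linarith) (by linarith)
  rw [sub_sub_cancel] at hr
  have hs2 : 1 / 2 ≤ s := by
    have : (1 / 2 : ℝ) ^ m₀ ≤ 1 / 2 := pow_le_of_le_one (by norm_num) (by norm_num) (by omega)
    linarith
  obtain ⟨hc1, hc2⟩ := fbmCov_one_bounds hH hs2 hs1
  set K : ℝ := (k + 1 : ℕ) * ε with hK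
  have hK0 : 0 < K := by positivity
  have hNle : B 1 ω ≤ x - K / x := by
    rw [le_sub_comm, div_le_iff₀ hx]
    exact hk1
  have hlow : x * (1 - s) / 2 + K / x / 2 < 6 * (√K / 6) * √(1 - s) := by
    refine lt_of_lt_of_le ?_ hr
    have h1 : fbmCov H s 1 * B 1 ω ≤ fbmCov H s 1 * (x - K / x) := by gcongr
    have h2 : fbmCov H s 1 * x ≤ (1 - (1 - s) / 2) * x := by gcongr
    have h3 : 1 / 2 * (K / x) ≤ fbmCov H s 1 * (K / x) := by gcongr
    linarith
  have hsx0 : 0 ≤ x * (1 - s) := mul_nonneg hx.le (by linarith)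
  have hKx : 0 ≤ K / x := by positivity
  have hprod : √K * √(1 - s) = √(x * (1 - s)) * √(K / x) := by
    rw [← Real.sqrt_mul hK0.le, ← Real.sqrt_mul hsx0]
    congr 1
    field_simp
  nlinarith [sq_nonneg (√(x * (1 - s)) - √(K / x)), Real.sq_sqrt hsx0, Real.sq_sqrt hKx]

lemma tail_exponent_bound {H ε : ℝ} (hH : 1 / 2 < H) (hε : 0 < ε) :
    ∀ᶠ N : ℕ in atTop, 2 * N + 1 + 6 * ε ≤ ε / 72 * ((2 : ℝ) ^ (2 * H - 1)) ^ N := by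
  set r := (2 : ℝ) ^ (2 * H - 1) with hr
  have hr1 : 1 < r := Real.one_lt_rpow (by norm_num) (by linarith)
  have h1 := tendsto_pow_const_div_const_pow_of_one_lt 1 hr1
  have h0 := tendsto_pow_const_div_const_pow_of_one_lt 0 hr1
  have h2 := (h1.const_mul 2).add (h0.const_mul (1 + 6 * ε))
  rw [mul_zero, mul_zero, add_zero] at h2
  filter_upwards [h2.eventually (gt_mem_nhds (by positivity : 0 < ε / 72))] with N hN
  have hrN : 0 < r ^ N := by positivity
  rw [pow_one, pow_zero, mul_div_assoc', mul_div_assoc', ← add_div, div_lt_iff₀ hrN] at hN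
  linarith

variable {Ω : Type*} [MeasurableSpace Ω]

lemma IsFBM.measure_large_increment_le {P : Measure Ω} [IsProbabilityMeasure P] {H : ℝ}
    (hH : 1 / 2 < H) {B : ℝ → Ω → ℝ} (hB : IsFBM P H B) {ε : ℝ} (hε : 0 < ε) {x : ℝ}
    (hx : 1 ≤ x) {N : ℕ} (hN : 2 * N + 1 + 6 * ε ≤ ε / 72 * ((2 : ℝ) ^ (2 * H - 1)) ^ N) (k : ℕ) :
    P (⋃ j ∈ Finset.range (2 ^ N), ({ω | x - (k + 2 : ℕ) * ε / x < B 1 ω} ∩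
      {ω | √((k + 1 : ℕ) * ε) / 6 * √(1 / 2 : ℝ) ^ N <
        regressedIncrement H B (1 - (j + 1 : ℕ) / 2 ^ N) (1 - (j : ℕ) / 2 ^ N) ω})) ≤
    ENNReal.ofReal (6 * Real.exp (-N) * Real.exp (-((k + 1 : ℕ) * 1))) * normalTail x := by
  have hx0 : 0 < x := by linarith
  have hp : (0 : ℝ) < 2 ^ N := by positivity
  have hterm : ∀ j ∈ Finset.range (2 ^ N), P ({ω | x - (k + 2 : ℕ) * ε / x < B 1 ω} ∩
      {ω | √((k + 1 : ℕ) * ε) / 6 * √(1 / 2 : ℝ) ^ N <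
        regressedIncrement H B (1 - (j + 1 : ℕ) / 2 ^ N) (1 - (j : ℕ) / 2 ^ N) ω}) ≤
      ENNReal.ofReal (6 * Real.exp (3 * ((k + 2 : ℕ) * ε))) * normalTail x *
        ENNReal.ofReal (Real.exp (-((k + 1 : ℕ) * ε / 72 * ((2 : ℝ) ^ (2 * H - 1)) ^ N))) := by
    intro j hj
    rw [Finset.mem_range] at hj
    have hj' : ((j + 1 : ℕ) : ℝ) ≤ 2 ^ N := by exact_mod_cast hj
    have hj'' : (j : ℝ) ≤ 2 ^ N := by push_cast at hj'; linarith
    refine (hB.measure_one_gt_inter_le (by linarith) ?_ ?_ _ (by positivity)).trans ?_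
    · rw [sub_nonneg, div_le_one hp]
      exact hj'
    · rw [sub_nonneg, div_le_one hp]
      exact hj''
    · gcongr ?_ * ?_
      · have := normalTail_sub_le hx (by positivity : 0 ≤ (k + 2 : ℕ) * ε / x)
        rwa [mul_div_cancel₀ _ hx0.ne'] at this
      · apply ENNReal.ofReal_le_ofReal
        apply Real.exp_le_exp.2
        apply le_of_eq
        have e1 : |1 - (j : ℝ) / 2 ^ N - (1 - (j + 1 : ℕ) / 2 ^ N)| = (2 ^ N)⁻¹ := by
          rw [abs_of_nonneg] <;> push_cast <;> ring_nf
          positivity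
        have e2 : ((2 : ℝ) ^ N)⁻¹ ^ (2 * H) = ((2 : ℝ) ^ N)⁻¹ * (((2 : ℝ) ^ (2 * H - 1)) ^ N)⁻¹ := by
          rw [Real.inv_rpow hp.le, ← mul_inv, ← Real.rpow_natCast, ← Real.rpow_natCast,
            ← Real.rpow_mul (by norm_num), ← Real.rpow_mul (by norm_num),
            ← Real.rpow_add (by norm_num)]
          ring_nf
        have e3 : (√((k + 1 : ℕ) * ε) / 6 * √(1 / 2 : ℝ) ^ N) ^ 2 =
            (k + 1 : ℕ) * ε / 36 * (2 ^ N)⁻¹ := by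
          rw [mul_pow, div_pow, Real.sq_sqrt (by positivity), ← pow_mul, mul_comm N 2, pow_mul,
            Real.sq_sqrt (by norm_num), one_div, inv_pow]
          norm_num
        rw [e1, e2, e3]
        have : (0 : ℝ) < ((2 : ℝ) ^ (2 * H - 1)) ^ N := by positivity
        field_simp
        norm_num
  refine (measure_biUnion_finset_le _ _).trans ((Finset.sum_le_sum hterm).trans ?_)
  rw [Finset.sum_const, Finset.card_range, nsmul_eq_mul]
  rw [mul_right_comm, ← mul_assoc, ← ENNReal.ofReal_natCast,
    ← ENNReal.ofReal_mul (by positivity), ← ENNReal.ofReal_mul (by positivity)]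
  gcongr ENNReal.ofReal ?_ * _
  have h2 : ((2 ^ N : ℕ) : ℝ) ≤ Real.exp N := by
    have : (2 : ℝ) ≤ Real.exp 1 := by
      have := Real.add_one_le_exp (1 : ℝ)
      linarith
    rw [← mul_one (N : ℝ), Real.exp_nat_mul]
    push_cast
    gcongr
  calc ((2 ^ N : ℕ) : ℝ) * (6 * Real.exp (3 * ((k + 2 : ℕ) * ε)) *
        Real.exp (-((k + 1 : ℕ) * ε / 72 * ((2 : ℝ) ^ (2 * H - 1)) ^ N)))
      ≤ Real.exp N * (6 * Real.exp (3 * ((k + 2 : ℕ) * ε)) *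
        Real.exp (-((k + 1 : ℕ) * ε / 72 * ((2 : ℝ) ^ (2 * H - 1)) ^ N))) := by gcongr
    _ = 6 * Real.exp (N + 3 * ((k + 2 : ℕ) * ε) +
        (-((k + 1 : ℕ) * ε / 72 * ((2 : ℝ) ^ (2 * H - 1)) ^ N))) := by
      rw [Real.exp_add, Real.exp_add]; ring
    _ ≤ 6 * Real.exp (-N + -((k + 1 : ℕ) * 1)) := by
      refine mul_le_mul_of_nonneg_left (Real.exp_le_exp.2 ?_) (by norm_num)
      have h3 := mul_le_mul_of_nonneg_left hN (by positivity : 0 ≤ ((k + 1 : ℕ) : ℝ))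
      push_cast at h3 ⊢
      have h4 : (0 : ℝ) ≤ k * ε := by positivity
      have h5 : (0 : ℝ) ≤ k * N := by positivity
      linarith
    _ = 6 * Real.exp (-N) * Real.exp (-((k + 1 : ℕ) * 1)) := by rw [Real.exp_add]; ring

/-- On a short interval ending at time `1`, the supremum of a fractional Brownian motion with
`H > 1/2` has asymptotically the same tail as the value at time `1`. -/
theorem exists_measure_exceed_near_one_le {H : ℝ} (hH : 1 / 2 < H) {ε : ℝ} (hε : 0 < ε) :
    ∃ m₀ : ℕ, 1 ≤ m₀ ∧ ∃ x₀ : ℝ, 1 ≤ x₀ ∧ ∀ {Ω : Type*} [MeasurableSpace Ω] (P : Measure Ω)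
      [IsProbabilityMeasure P] (B : ℝ → Ω → ℝ), IsFBM P H B → ∀ x, x₀ ≤ x →
      P {ω | ∃ s ∈ Icc (1 - (1 / 2 : ℝ) ^ m₀) 1, x < B s ω} ≤
        ENNReal.ofReal (1 + ε) * normalTail x := by
  set e := Real.log (1 + ε / 2) / 2 with he
  have he0 : 0 < e := by
    have := Real.log_pos (by linarith : 1 < 1 + ε / 2)
    positivity
  have hexp : Real.exp (2 * e) = 1 + ε / 2 := by
    rw [he, mul_div_cancel₀ _ two_ne_zero, Real.exp_log (by positivity)]
  obtain ⟨x₀, hx₀, hshift⟩ := normalTail_sub_div_le he0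
  have hlim : Tendsto (fun m : ℕ => 6 * Real.exp (-(m : ℝ))) atTop (nhds 0) := by
    rw [← mul_zero (6 : ℝ)]
    exact (Real.tendsto_exp_neg_atTop_nhds_zero.comp tendsto_natCast_atTop_atTop).const_mul 6
  obtain ⟨m₁, hm₁⟩ := eventually_atTop.1
    ((tail_exponent_bound hH he0).and (hlim.eventually (gt_mem_nhds (half_pos hε))))
  refine ⟨m₁ + 1, by omega, x₀, hx₀, fun {Ω} _ P _ B hB x hx => ?_⟩
  have hx1 : 1 ≤ x := hx₀.trans hx
  have hx0 : 0 < x := by linarith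
  set U : ℕ → ℕ → Set Ω := fun k n => ⋃ j ∈ Finset.range (2 ^ (n + (m₁ + 1))),
    ({ω | x - (k + 2 : ℕ) * e / x < B 1 ω} ∩
      {ω | √((k + 1 : ℕ) * e) / 6 * √(1 / 2 : ℝ) ^ (n + (m₁ + 1)) <
        regressedIncrement H B (1 - (j + 1 : ℕ) / 2 ^ (n + (m₁ + 1)))
          (1 - (j : ℕ) / 2 ^ (n + (m₁ + 1))) ω}) with hU
  have hsub : ({ω | ∃ s ∈ Icc (1 - (1 / 2 : ℝ) ^ (m₁ + 1)) 1, x < B s ω} : Set Ω) ≤ᵐ[P]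
      (({ω | x - e / x < B 1 ω} ∪ ⋃ k, ⋃ n, U k n : Set Ω)) := by
    filter_upwards [hB.2.1] with ω hω
    rintro ⟨s, hs, hsx⟩
    by_cases hN : x - e / x < B 1 ω
    · exact Or.inl hN
    · right
      obtain ⟨k, n, j, hj, h1, h2⟩ := exists_large_regressedIncrement hH hω
        (by omega : 1 ≤ m₁ + 1) he0 hx0 (not_lt.1 hN) hs.1 hs.2 hsx
      simp only [hU, mem_iUnion]
      exact ⟨k, n, j, Finset.mem_range.2 hj, h1, h2⟩
  have hsum : ∑' k : ℕ, ∑' n : ℕ, P (U k n) ≤ ENNReal.ofReal (ε / 2) * normalTail x := by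
    have h1 : ∀ k n : ℕ, P (U k n) ≤ ENNReal.ofReal (6 * Real.exp (-(m₁ : ℝ))) * normalTail x *
        ENNReal.ofReal (Real.exp (-((k + 1 : ℕ) * 1))) *
        ENNReal.ofReal (Real.exp (-((n + 1 : ℕ) * 1))) := by
      intro k n
      refine (hB.measure_large_increment_le hH he0 hx1 (hm₁ _ (by omega)).1 k).trans ?_
      apply le_of_eq
      rw [mul_right_comm _ (normalTail x), mul_right_comm _ (normalTail x), ← ENNReal.ofReal_mul (by positivity),
        ← ENNReal.ofReal_mul (by positivity)]
      congr 2
      have : Real.exp (-((n + (m₁ + 1) : ℕ) : ℝ)) =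
          Real.exp (-(m₁ : ℝ)) * Real.exp (-((n + 1 : ℕ) * 1)) := by
        rw [← Real.exp_add]
        congr 1
        push_cast
        ring
      rw [this]
      ring
    have h2 : ∑' n : ℕ, ENNReal.ofReal (Real.exp (-((n + 1 : ℕ) * 1))) ≤ 1 := by
      refine (ENNReal.tsum_ofReal_exp_neg_succ (by linarith [Real.log_two_lt_d9])).trans ?_
      rw [← ENNReal.ofReal_one]
      gcongr
      rw [Real.exp_neg, ← div_eq_mul_inv, div_le_one (Real.exp_pos _)]
      linarith [Real.add_one_le_exp (1 : ℝ)]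
    calc ∑' k : ℕ, ∑' n : ℕ, P (U k n)
        ≤ ∑' k : ℕ, ∑' n : ℕ, ENNReal.ofReal (6 * Real.exp (-(m₁ : ℝ))) * normalTail x *
          ENNReal.ofReal (Real.exp (-((k + 1 : ℕ) * 1))) *
          ENNReal.ofReal (Real.exp (-((n + 1 : ℕ) * 1))) :=
          ENNReal.tsum_le_tsum fun k => ENNReal.tsum_le_tsum fun n => h1 k n
      _ = ENNReal.ofReal (6 * Real.exp (-(m₁ : ℝ))) * normalTail x *
          (∑' k : ℕ, ENNReal.ofReal (Real.exp (-((k + 1 : ℕ) * 1)))) *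
          ∑' n : ℕ, ENNReal.ofReal (Real.exp (-((n + 1 : ℕ) * 1))) := by
        simp_rw [ENNReal.tsum_mul_left]
        rw [ENNReal.tsum_mul_right, ENNReal.tsum_mul_left]
      _ ≤ ENNReal.ofReal (6 * Real.exp (-(m₁ : ℝ))) * normalTail x * 1 * 1 := by gcongr
      _ ≤ ENNReal.ofReal (ε / 2) * normalTail x := by
        rw [mul_one, mul_one]
        gcongr
        exact (hm₁ m₁ le_rfl).2.le
  calc P {ω | ∃ s ∈ Icc (1 - (1 / 2 : ℝ) ^ (m₁ + 1)) 1, x < B s ω}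
      ≤ P ({ω | x - e / x < B 1 ω} ∪ ⋃ k, ⋃ n, U k n) := measure_mono_ae hsub
    _ ≤ P {ω | x - e / x < B 1 ω} + ∑' k : ℕ, ∑' n : ℕ, P (U k n) := by
      refine (measure_union_le _ _).trans ?_
      gcongr
      exact (measure_iUnion_le _).trans (ENNReal.tsum_le_tsum fun k => measure_iUnion_le _)
    _ ≤ ENNReal.ofReal (1 + ε / 2) * normalTail x + ENNReal.ofReal (ε / 2) * normalTail x := by
      gcongr
      rw [hB.measure_one_gt (by linarith), ← hexp]
      exact hshift x hx
    _ = ENNReal.ofReal (1 + ε) * normalTail x := by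
      rw [← add_mul, ← ENNReal.ofReal_add (by positivity) (by positivity)]
      ring_nf

end

section

variable {Ω : Type*} [MeasurableSpace Ω]

lemma fbmCov_mul {H a s t : ℝ} (ha : 0 ≤ a) (hs : 0 ≤ s) (ht : 0 ≤ t) :
    fbmCov H (a * s) (a * t) = a ^ (2 * H) * fbmCov H s t := by
  rw [fbmCov, fbmCov, ← mul_sub, abs_mul, abs_of_nonneg ha, Real.mul_rpow ha hs,
    Real.mul_rpow ha ht, Real.mul_rpow ha (abs_nonneg _)]
  ring

lemma IsFBM.rescale {P : Measure Ω} {H : ℝ} {B : ℝ → Ω → ℝ} (hB : IsFBM P H B) {a : ℝ}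
    (ha : 0 < a) : IsFBM P H (fun s ω => B (a * s) ω / a ^ H) := by
  have haH : 0 < a ^ H := Real.rpow_pos_of_pos ha H
  refine ⟨⟨fun t => (hB.1.1 _).div_const _, fun n t c ht => ?_⟩, ?_, ?_⟩
  · obtain ⟨v, hv, hlaw⟩ := hB.1.2 n (fun i => a * t i) (fun i => c i / a ^ H)
      (fun i => mul_nonneg ha.le (ht i))
    refine ⟨v, ?_, ?_⟩
    · rw [hv]
      refine Finset.sum_congr rfl fun i _ => Finset.sum_congr rfl fun j _ => ?_
      rw [fbmCov_mul ha.le (ht i) (ht j), mul_comm 2 H, Real.rpow_mul ha.le, Real.rpow_two]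
      field_simp
    · rw [← hlaw]
      congr 1
      ext ω
      refine Finset.sum_congr rfl fun i _ => ?_
      ring
  · filter_upwards [hB.2.1] with ω hω
    refine ContinuousOn.div_const ?_ _
    exact hω.comp (by fun_prop) fun s hs => mul_nonneg ha.le hs
  · filter_upwards [hB.2.2] with ω hω
    rw [mul_zero, hω, zero_div]

/-- Tail of the supremum over `[0, 1]` of a fractional Brownian motion with `H > 1/2`. -/
theorem exists_measure_exceed_unit_le {H : ℝ} (hH : 1 / 2 < H) {ε : ℝ} (hε : 0 < ε) :
    ∃ x₀ : ℝ, 1 ≤ x₀ ∧ ∀ {Ω : Type*} [MeasurableSpace Ω] (P : Measure Ω)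
      [IsProbabilityMeasure P] (B : ℝ → Ω → ℝ), IsFBM P H B → ∀ x, x₀ ≤ x →
      P {ω | ∃ s ∈ Icc (0 : ℝ) 1, x < B s ω} ≤ ENNReal.ofReal (1 + ε) * normalTail x := by
  have hH0 : 0 < H := by linarith
  obtain ⟨m₀, hm₀, x₁, hx₁, hblock⟩ := exists_measure_exceed_near_one_le hH (half_pos hε)
  set ρ : ℝ := 1 - (1 / 2 : ℝ) ^ m₀ with hρ
  have hhalf : (1 / 2 : ℝ) ^ m₀ ≤ 1 / 2 := pow_le_of_le_one (by norm_num) (by norm_num) (by omega)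
  have hhalf0 : (0 : ℝ) < (1 / 2 : ℝ) ^ m₀ := by positivity
  have hρ0 : 0 < ρ := by linarith
  have hρ1 : ρ < 1 := by linarith
  set μ : ℝ := (ρ ^ H)⁻¹ with hμ
  have hμ1 : 1 < μ := (one_lt_inv₀ (Real.rpow_pos_of_pos hρ0 _)).2
    (Real.rpow_lt_one hρ0.le hρ1 hH0)
  have hκ : 0 < μ ^ 2 - 1 := by nlinarith
  obtain ⟨x₂, hsum⟩ := tsum_exp_le_normalTail hκ (by positivity : 0 < ε / 2 / (1 + ε / 2))
  refine ⟨max x₁ x₂, hx₁.trans (le_max_left _ _), fun {Ω} _ P _ B hB x hx => ?_⟩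
  have hxx₁ : x₁ ≤ x := (le_max_left _ _).trans hx
  have hxx₂ : x₂ ≤ x := (le_max_right _ _).trans hx
  have hx0 : 0 < x := by linarith
  have hscale : ∀ n : ℕ, ((ρ ^ n) ^ H)⁻¹ = μ ^ n := by
    intro n
    rw [hμ, inv_pow, ← Real.rpow_natCast, ← Real.rpow_natCast, ← Real.rpow_mul hρ0.le,
      ← Real.rpow_mul hρ0.le, mul_comm]
  have hterm : ∀ n : ℕ, P {ω | ∃ s ∈ Icc (ρ ^ (n + 1)) (ρ ^ n), x < B s ω} ≤
      ENNReal.ofReal (1 + ε / 2) * normalTail (μ ^ n * x) := by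
    intro n
    have hn : 0 < ρ ^ n := pow_pos hρ0 n
    have hnH : 0 < (ρ ^ n) ^ H := Real.rpow_pos_of_pos hn H
    refine le_trans (measure_mono ?_) (hblock P _ (hB.rescale hn) (μ ^ n * x) ?_)
    · rintro ω ⟨s, hs, hsx⟩
      refine ⟨s / ρ ^ n, ⟨?_, ?_⟩, ?_⟩
      · rw [le_div_iff₀ hn, ← pow_succ']
        exact hs.1
      · rw [div_le_one hn]
        exact hs.2
      · rw [mul_div_cancel₀ _ hn.ne', ← hscale, inv_mul_eq_div]
        gcongr
    · have := one_le_pow₀ hμ1.le (n := n)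
      nlinarith
  have hsub : ({ω | ∃ s ∈ Icc (0 : ℝ) 1, x < B s ω} : Set Ω) ≤ᵐ[P]
      ((⋃ n : ℕ, {ω | ∃ s ∈ Icc (ρ ^ (n + 1)) (ρ ^ n), x < B s ω} : Set Ω)) := by
    filter_upwards [hB.2.2] with ω hω
    rintro ⟨s, hs, hsx⟩
    have hs0 : 0 < s := by
      rcases hs.1.eq_or_lt with rfl | h
      · linarith
      · exact h
    obtain ⟨n, hn1, hn2⟩ := exists_nat_pow_near_of_lt_one hs0 hs.2 hρ0 hρ1
    exact mem_iUnion.2 ⟨n, s, ⟨hn1.le, hn2⟩, hsx⟩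
  have htail : ∀ n : ℕ, normalTail (μ ^ (n + 1) * x) ≤
      ENNReal.ofReal (Real.exp (-((1 + (n + 1 : ℕ) * (μ ^ 2 - 1)) * x ^ 2 / 2))) := by
    intro n
    refine (normalTail_le_exp (by positivity)).trans (ENNReal.ofReal_le_ofReal
      (Real.exp_le_exp.2 ?_))
    have h1 := one_add_mul_le_pow (by linarith : (-2 : ℝ) ≤ μ ^ 2 - 1) (n + 1)
    rw [add_sub_cancel, ← pow_mul, mul_comm 2, pow_mul] at h1
    rw [mul_pow]
    have := mul_le_mul_of_nonneg_right h1 (sq_nonneg x)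
    linarith
  calc P {ω | ∃ s ∈ Icc (0 : ℝ) 1, x < B s ω}
      ≤ P (⋃ n : ℕ, {ω | ∃ s ∈ Icc (ρ ^ (n + 1)) (ρ ^ n), x < B s ω}) := measure_mono_ae hsub
    _ ≤ ∑' n : ℕ, ENNReal.ofReal (1 + ε / 2) * normalTail (μ ^ n * x) :=
      (measure_iUnion_le _).trans (ENNReal.tsum_le_tsum hterm)
    _ = ENNReal.ofReal (1 + ε / 2) *
        (normalTail x + ∑' n : ℕ, normalTail (μ ^ (n + 1) * x)) := by
      rw [ENNReal.tsum_mul_left, tsum_eq_zero_add' ENNReal.summable, pow_zero, one_mul]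
    _ ≤ ENNReal.ofReal (1 + ε / 2) *
        (normalTail x + ENNReal.ofReal (ε / 2 / (1 + ε / 2)) * normalTail x) := by
      gcongr
      exact (ENNReal.tsum_le_tsum htail).trans (hsum x hxx₂)
    _ = ENNReal.ofReal (1 + ε) * normalTail x := by
      rw [← one_add_mul, ← mul_assoc, ← ENNReal.ofReal_one,
        ← ENNReal.ofReal_add zero_le_one (by positivity), ← ENNReal.ofReal_mul (by positivity)]
      congr 2
      field_simp
      ring

lemma IsFBM.measure_gt {P : Measure Ω} {H : ℝ} (hH : 0 < H) {B : ℝ → Ω → ℝ}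
    (hB : IsFBM P H B) {t : ℝ} (ht : 0 < t) (u : ℝ) :
    P {ω | u < B t ω} = normalTail (u / t ^ H) := by
  rw [← (hB.rescale ht).measure_one_gt hH]
  congr 1
  ext ω
  simp only [mem_ofPred_eq, mul_one]
  rw [div_lt_div_iff_of_pos_right (Real.rpow_pos_of_pos ht H)]

/-- The event that a path exceeds `u` at some nonnegative rational time before `t`. -/
def rationalExceedance (B : ℝ → Ω → ℝ) (u t : ℝ) : Set Ω :=
  {ω | ∃ q : {q : ℚ // 0 ≤ q}, ((q : ℚ) : ℝ) < t ∧ u < B ((q : ℚ) : ℝ) ω}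

lemma exists_rat_lt_of_continuousOn {f : ℝ → ℝ} (hf : ContinuousOn f (Ici 0)) {u s : ℝ}
    (hs : 0 < s) (hfs : u < f s) :
    ∃ q : {q : ℚ // 0 ≤ q}, ((q : ℚ) : ℝ) < s ∧ u < f ((q : ℚ) : ℝ) := by
  have h1 : ∀ᶠ r in nhds s, u < f r :=
    (hf.continuousAt (Ici_mem_nhds hs)).eventually (lt_mem_nhds hfs)
  obtain ⟨l, hl, hlr⟩ := exists_Ioc_subset_of_mem_nhds h1 ⟨s - 1, by linarith⟩
  obtain ⟨q, hq1, hq2⟩ := exists_rat_btwn (max_lt hl hs)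
  have hq0 : (0 : ℝ) < q := (le_max_right _ _).trans_lt hq1
  exact ⟨⟨q, by exact_mod_cast hq0.le⟩, hq2, hlr ⟨(le_max_left _ _).trans_lt hq1, hq2.le⟩⟩

lemma IsFBM.ae_lt_sSup_iff {P : Measure Ω} {H : ℝ} {B : ℝ → Ω → ℝ} (hB : IsFBM P H B)
    {u : ℝ} (hu : 0 < u) :
    ∀ᵐ ω ∂P, ∀ t, 0 ≤ t → (u < sSup ((fun s => B s ω) '' Icc 0 t) ↔
      ω ∈ rationalExceedance B u t) := by
  filter_upwards [hB.2.1, hB.2.2] with ω hc h0 t ht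
  have hbdd : BddAbove ((fun s => B s ω) '' Icc 0 t) :=
    (isCompact_Icc.image_of_continuousOn (hc.mono Icc_subset_Ici_self)).bddAbove
  have hne : ((fun s => B s ω) '' Icc 0 t).Nonempty := (nonempty_Icc.2 ht).image _
  rw [lt_csSup_iff hbdd hne]
  constructor
  · rintro ⟨_, ⟨s, hs, rfl⟩, hus⟩
    have hs0 : 0 < s := by
      rcases hs.1.eq_or_lt with rfl | h
      · simp only [h0] at hus
        linarith
      · exact h
    obtain ⟨q, hq1, hq2⟩ := exists_rat_lt_of_continuousOn hc hs0 hus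
    exact ⟨q, hq1.trans_le hs.2, hq2⟩
  · rintro ⟨q, hq1, hq2⟩
    exact ⟨_, ⟨_, ⟨by exact_mod_cast q.2, hq1.le⟩, rfl⟩, hq2⟩

lemma IsFBM.normalTail_le_measure_rationalExceedance {P : Measure Ω} {H : ℝ} (hH : 0 < H)
    {B : ℝ → Ω → ℝ} (hB : IsFBM P H B) {t : ℝ} (ht : 0 < t) (u : ℝ) :
    normalTail (u / t ^ H) ≤ P (rationalExceedance B u t) := by
  rw [← hB.measure_gt hH ht]
  apply measure_mono_ae
  filter_upwards [hB.2.1] with ω hc hω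
  exact exists_rat_lt_of_continuousOn hc ht hω

lemma IsFBM.measure_rationalExceedance_le {P : Measure Ω} {H : ℝ}
    {B : ℝ → Ω → ℝ} (hB : IsFBM P H B) {t : ℝ} (ht : 0 < t) {u : ℝ} {b : ENNReal}
    (h : ∀ B' : ℝ → Ω → ℝ, IsFBM P H B' → P {ω | ∃ s ∈ Icc (0 : ℝ) 1, u / t ^ H < B' s ω} ≤ b) :
    P (rationalExceedance B u t) ≤ b := by
  refine le_trans (measure_mono ?_) (h _ (hB.rescale ht))
  rintro ω ⟨q, hq1, hq2⟩
  have hq0 : (0 : ℝ) ≤ (q : ℚ) := by exact_mod_cast q.2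
  refine ⟨((q : ℚ) : ℝ) / t, ⟨by positivity, by rw [div_le_one ht]; exact hq1.le⟩, ?_⟩
  rw [mul_div_cancel₀ _ ht.ne']
  have := Real.rpow_pos_of_pos ht H
  gcongr

lemma measure_rationalExceedance_random {P : Measure Ω} [IsProbabilityMeasure P]
    {B : ℝ → Ω → ℝ} (hBm : ∀ t, Measurable (B t)) {T : Ω → ℝ} (hTm : Measurable T)
    (hInd : Indep (MeasurableSpace.comap T inferInstance)
      (⨆ t ∈ Set.Ici (0 : ℝ), MeasurableSpace.comap (B t) inferInstance) P) (u : ℝ) :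
    P {ω | ω ∈ rationalExceedance B u (T ω)} =
      ∫⁻ t, P (rationalExceedance B u t) ∂(P.map T) := by
  set Y : Ω → {q : ℚ // 0 ≤ q} → ℝ := fun ω q => B ((q : ℚ) : ℝ) ω with hY
  have hYm : Measurable Y := measurable_pi_lambda _ fun q => hBm _
  have hind : IndepFun T Y P := by
    rw [IndepFun_iff_Indep]
    refine indep_of_indep_of_le_right hInd ?_
    rw [MeasurableSpace.pi, MeasurableSpace.comap_iSup]
    refine iSup_le fun q => ?_
    rw [MeasurableSpace.comap_comp]
    exact le_iSup₂_of_le ((q : ℚ) : ℝ) (by exact_mod_cast q.2 : (0 : ℝ) ≤ ((q : ℚ) : ℝ)) le_rfl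
  set S : Set (ℝ × ({q : ℚ // 0 ≤ q} → ℝ)) := ⋃ q : {q : ℚ // 0 ≤ q},
    {p | ((q : ℚ) : ℝ) < p.1 ∧ u < p.2 q} with hS
  have hSm : MeasurableSet S := by
    refine MeasurableSet.iUnion fun q => ?_
    exact (measurableSet_lt measurable_const measurable_fst).inter
      (measurableSet_lt measurable_const ((measurable_pi_apply q).comp measurable_snd))
  have h1 : {ω | ω ∈ rationalExceedance B u (T ω)} = (fun ω => (T ω, Y ω)) ⁻¹' S := by
    ext ω
    simp [rationalExceedance, hS, hY]
  rw [h1, ← Measure.map_apply (hTm.prodMk hYm) hSm,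
    (indepFun_iff_map_prod_eq_prod_map_map hTm.aemeasurable hYm.aemeasurable).1 hind,
    Measure.prod_apply hSm]
  refine lintegral_congr fun t => ?_
  rw [Measure.map_apply hYm (measurable_prodMk_left hSm)]
  congr 1
  ext ω
  simp [rationalExceedance, hS, hY]

/-- Upper tail of `N T ^ H` at `u > 0`, where `N` is standard normal and `T` has law `ν`. -/
def productTail (ν : Measure ℝ) (H u : ℝ) : ENNReal :=
  ∫⁻ x, (Ioi 0).indicator (fun x => ν (Ioi ((u / x) ^ (1 / H)))) x ∂(gaussianReal 0 1)

lemma productTail_eq {ν : Measure ℝ} [IsProbabilityMeasure ν] {H : ℝ} (hH : 0 < H) {u : ℝ}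
    (hu : 0 < u) : productTail ν H u =
      ∫⁻ t, (Ioi 0).indicator (fun t => normalTail (u / t ^ H)) t ∂ν := by
  set S : Set (ℝ × ℝ) := {p | 0 < p.1 ∧ u < p.2 * p.1 ^ H} with hS
  have hSm : MeasurableSet S := by
    have hf : Measurable fun p : ℝ × ℝ => p.2 * p.1 ^ H := by fun_prop
    have h₁ : MeasurableSet {p : ℝ × ℝ | 0 < p.1} := measurableSet_lt measurable_const measurable_fst
    have h₂ : MeasurableSet {p : ℝ × ℝ | u < p.2 * p.1 ^ H} :=
      measurableSet_lt measurable_const hf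
    exact h₁.inter h₂
  have h1 : (ν.prod (gaussianReal 0 1)) S =
      ∫⁻ t, (Ioi 0).indicator (fun t => normalTail (u / t ^ H)) t ∂ν := by
    rw [Measure.prod_apply hSm]
    refine lintegral_congr fun t => ?_
    by_cases ht : 0 < t
    · rw [indicator_of_mem (mem_Ioi.2 ht), normalTail]
      congr 1
      ext x
      have := Real.rpow_pos_of_pos ht H
      simp [hS, ht, div_lt_iff₀ this]
    · rw [indicator_of_notMem (by simpa using ht)]
      have : Prod.mk t ⁻¹' S = ∅ := by
        ext x
        simp [hS, ht]
      rw [this, measure_empty]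
  rw [← h1, Measure.prod_apply_symm hSm, productTail]
  refine lintegral_congr fun x => ?_
  by_cases hx : 0 < x
  · rw [indicator_of_mem (mem_Ioi.2 hx)]
    congr 1
    ext t
    have hux : 0 < u / x := div_pos hu hx
    have hr0 : 0 < (u / x) ^ (1 / H) := Real.rpow_pos_of_pos hux _
    simp only [mem_Ioi, hS, mem_preimage, mem_ofPred_eq]
    rw [← div_lt_iff₀' hx]
    constructor
    · intro h
      have ht := hr0.trans h
      refine ⟨ht, ?_⟩
      have := Real.rpow_lt_rpow hr0.le h hH
      rwa [← Real.rpow_mul hux.le, one_div_mul_cancel hH.ne', Real.rpow_one] at this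
    · rintro ⟨ht, h⟩
      have := Real.rpow_lt_rpow hux.le h (one_div_pos.2 hH)
      rwa [← Real.rpow_mul ht.le, mul_one_div_cancel hH.ne', Real.rpow_one] at this
  · rw [indicator_of_notMem (by simpa using hx)]
    have : (fun t => (t, x)) ⁻¹' S = ∅ := by
      ext t
      simp only [hS, mem_preimage, mem_ofPred_eq, mem_empty_iff_false, iff_false, not_and, not_lt]
      intro ht
      have := Real.rpow_pos_of_pos ht H
      nlinarith
    rw [this, measure_empty]

/-- Two-sided comparison of the supremum over a random time horizon with `N T ^ H`. -/
theorem IsFBM.measure_sSup_bounds {P : Measure Ω} [IsProbabilityMeasure P] {H : ℝ}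
    (hH : 1 / 2 < H) {B : ℝ → Ω → ℝ} (hB : IsFBM P H B) {T : Ω → ℝ} (hTm : Measurable T)
    (hTnn : ∀ ω, 0 ≤ T ω)
    (hInd : Indep (MeasurableSpace.comap T inferInstance)
      (⨆ t ∈ Set.Ici (0 : ℝ), MeasurableSpace.comap (B t) inferInstance) P)
    {ε : ℝ} (hε : 0 < ε) :
    ∃ x₀ : ℝ, 0 < x₀ ∧ ∀ u, 0 < u →
      productTail (P.map T) H u ≤ P {ω | u < sSup ((fun s => B s ω) '' Icc 0 (T ω))} ∧
      P {ω | u < sSup ((fun s => B s ω) '' Icc 0 (T ω))} ≤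
        ENNReal.ofReal (1 + ε) * productTail (P.map T) H u +
          P.map T (Ioi ((u / x₀) ^ (1 / H))) := by
  have hH0 : 0 < H := by linarith
  obtain ⟨x₀, hx₀, hsup⟩ := exists_measure_exceed_unit_le hH hε
  have : IsProbabilityMeasure (P.map T) := Measure.isProbabilityMeasure_map hTm.aemeasurable
  refine ⟨x₀, by linarith, fun u hu => ?_⟩
  have hx0 : 0 < x₀ := by linarith
  have h1 : P {ω | u < sSup ((fun s => B s ω) '' Icc 0 (T ω))} =
      ∫⁻ t, P (rationalExceedance B u t) ∂(P.map T) := by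
    rw [← measure_rationalExceedance_random hB.measurable hTm hInd]
    apply measure_congr
    filter_upwards [hB.ae_lt_sSup_iff hu] with ω hω
    exact propext (hω (T ω) (hTnn ω))
  rw [h1, productTail_eq hH0 hu]
  constructor
  · refine lintegral_mono fun t => ?_
    by_cases ht : 0 < t
    · rw [indicator_of_mem (mem_Ioi.2 ht)]
      exact hB.normalTail_le_measure_rationalExceedance hH0 ht u
    · rw [indicator_of_notMem (by simpa using ht)]
      exact zero_le
  · have hbound : ∀ t, P (rationalExceedance B u t) ≤
        ENNReal.ofReal (1 + ε) * (Ioi 0).indicator (fun t => normalTail (u / t ^ H)) t +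
          (Ioi ((u / x₀) ^ (1 / H))).indicator 1 t := by
      intro t
      by_cases ht : 0 < t
      · have htH := Real.rpow_pos_of_pos ht H
        rw [indicator_of_mem (mem_Ioi.2 ht)]
        by_cases hle : x₀ ≤ u / t ^ H
        · refine le_trans ?_ le_self_add
          exact hB.measure_rationalExceedance_le ht fun B' hB' => hsup P B' hB' _ hle
        · refine le_trans ?_ le_add_self
          rw [indicator_of_mem]
          · exact prob_le_one
          · rw [not_le, div_lt_comm₀ htH hx0] at hle
            have := Real.rpow_lt_rpow (by positivity) hle (one_div_pos.2 hH0)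
            rwa [← Real.rpow_mul ht.le, mul_one_div_cancel hH0.ne', Real.rpow_one] at this
      · have : rationalExceedance B u t = ∅ := by
          ext ω
          simp only [rationalExceedance, mem_ofPred_eq, mem_empty_iff_false, iff_false, not_exists,
            not_and]
          intro q hq
          have hq0 : (0 : ℝ) ≤ (q : ℚ) := by exact_mod_cast q.2
          linarith
        rw [this, measure_empty]
        exact zero_le
    refine (lintegral_mono hbound).trans ?_
    rw [lintegral_add_right _ (measurable_one.indicator measurableSet_Ioi),
      lintegral_const_mul' _ _ ENNReal.ofReal_ne_top, lintegral_indicator_one measurableSet_Ioi]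

end

/-- The exponent `z ^ 2 / 2 + z ^ (-p) / p`, minimized on `(0, ∞)` at `z = 1`. -/
def saddleExponent (p z : ℝ) : ℝ := z ^ 2 / 2 + z ^ (-p) / p

lemma saddleExponent_one (p : ℝ) : saddleExponent p 1 = 1 / 2 + 1 / p := by
  simp [saddleExponent]

lemma saddleExponent_sub_ge {p z : ℝ} (hp : 0 < p) (hz : 0 < z) :
    (z - 1) ^ 2 / 2 ≤ saddleExponent p z - saddleExponent p 1 := by
  have h1 : 1 - p * (z - 1) ≤ z ^ (-p) := by
    rw [Real.rpow_def_of_pos hz]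
    have h2 := Real.add_one_le_exp (Real.log z * -p)
    have h3 := mul_le_mul_of_nonneg_right (Real.log_le_sub_one_of_pos hz) hp.le
    linarith
  have h4 : (1 - p * (z - 1)) / p ≤ z ^ (-p) / p := by gcongr
  have h5 : (1 - p * (z - 1)) / p = 1 / p - (z - 1) := by field_simp
  rw [saddleExponent_one, saddleExponent]
  nlinarith

lemma tendsto_rpow_neg_second_order (p : ℝ) :
    Tendsto (fun z : ℝ => (z ^ (-p) - 1 + p * (z - 1)) / (z - 1) ^ 2) (nhdsWithin 1 {1}ᶜ)
      (nhds (p * (p + 1) / 2)) := by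
  have hpos : ∀ᶠ z : ℝ in nhdsWithin 1 {1}ᶜ, 0 < z :=
    nhdsWithin_le_nhds (lt_mem_nhds one_pos)
  have hne : ∀ᶠ z : ℝ in nhdsWithin 1 {1}ᶜ, z - 1 ≠ 0 := by
    filter_upwards [self_mem_nhdsWithin] with z hz
    exact sub_ne_zero.2 hz
  have hcont : ContinuousAt (fun z : ℝ => z ^ (-p) - 1 + p * (z - 1)) 1 := by
    have : ContinuousAt (fun z : ℝ => z ^ (-p)) 1 :=
      Real.continuousAt_rpow_const _ _ (Or.inl one_ne_zero)
    fun_prop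
  refine HasDerivAt.lhopital_zero_nhdsNE
    (f' := fun z => -p * z ^ (-p - 1) + p) (g' := fun z => 2 * (z - 1)) ?_ ?_ ?_ ?_ ?_ ?_
  · filter_upwards [hpos] with z hz
    have h1 := (Real.hasDerivAt_rpow_const (p := -p) (Or.inl hz.ne')).sub_const 1
    have h2 := ((hasDerivAt_id z).sub_const 1).const_mul p
    exact (h1.add h2).congr_deriv (by simp)
  · filter_upwards with z
    exact (((hasDerivAt_id z).sub_const 1).pow 2).congr_deriv (by simp)
  · filter_upwards [hne] with z hz
    exact mul_ne_zero two_ne_zero hz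
  · simpa using hcont.tendsto.mono_left nhdsWithin_le_nhds
  · have : Continuous fun z : ℝ => (z - 1) ^ 2 := by fun_prop
    simpa using (this.tendsto 1).mono_left nhdsWithin_le_nhds
  · have h1 := (Real.hasDerivAt_rpow_const (x := 1) (p := -p - 1) (Or.inl one_ne_zero)).const_mul
      (-p / 2)
    have h2 := h1.tendsto_slope
    rw [Real.one_rpow] at h2
    have h3 : -p / 2 * ((-p - 1) * 1) = p * (p + 1) / 2 := by ring
    rw [h3] at h2
    refine h2.congr' ?_
    filter_upwards [hne] with z hz
    rw [slope_def_field, Real.one_rpow]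
    field_simp
    ring

lemma tendsto_sq_mul_saddleExponent_sub {p : ℝ} (hp : 0 < p) (w : ℝ) :
    Tendsto (fun y : ℝ => y ^ 2 * (saddleExponent p ((y + w) / y) - saddleExponent p 1)) atTop
      (nhds ((p + 2) * w ^ 2 / 2)) := by
  rcases eq_or_ne w 0 with rfl | hw
  · refine tendsto_const_nhds.congr' ?_
    filter_upwards [eventually_gt_atTop 0] with y hy
    rw [add_zero, div_self hy.ne']
    ring
  have hz : Tendsto (fun y : ℝ => (y + w) / y) atTop (nhdsWithin 1 {1}ᶜ) := by
    refine tendsto_nhdsWithin_iff.2 ⟨?_, ?_⟩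
    · have h1 : Tendsto (fun y : ℝ => 1 + w / y) atTop (nhds (1 + 0)) :=
        tendsto_const_nhds.add (tendsto_const_nhds.div_atTop tendsto_id)
      rw [add_zero] at h1
      refine h1.congr' ?_
      filter_upwards [eventually_gt_atTop 0] with y hy
      field_simp
    · filter_upwards [eventually_gt_atTop 0] with y hy
      rw [mem_compl_singleton_iff, ne_eq, div_eq_one_iff_eq hy.ne']
      simpa using hw
  have h := (((tendsto_rpow_neg_second_order p).comp hz).const_mul (w ^ 2 / p)).const_add (w ^ 2 / 2)
  have h1 : w ^ 2 / 2 + w ^ 2 / p * (p * (p + 1) / 2) = (p + 2) * w ^ 2 / 2 := by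
    field_simp
    ring
  rw [h1] at h
  refine h.congr' ?_
  filter_upwards [eventually_gt_atTop 0] with y hy
  have h2 : (y + w) / y - 1 = w / y := by field_simp; ring
  rw [Function.comp_apply, saddleExponent_one, saddleExponent, h2]
  field_simp
  ring

/-- The time scale `(y ^ 2 / (p * b)) ^ (1 / a)` solving `b * t ^ a = y ^ 2 / p`. -/
def timeScale (a b p y : ℝ) : ℝ := (y ^ 2 / (p * b)) ^ (1 / a)

section TimeScale

variable {a b p y : ℝ}

lemma timeScale_pos (hb : 0 < b) (hp : 0 < p) (hy : 0 < y) : 0 < timeScale a b p y :=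
  Real.rpow_pos_of_pos (by positivity) _

lemma mul_timeScale_rpow (ha : 0 < a) (hb : 0 < b) (hp : 0 < p) :
    b * timeScale a b p y ^ a = y ^ 2 / p := by
  rw [timeScale, ← Real.rpow_mul (by positivity), one_div_mul_cancel ha.ne', Real.rpow_one]
  field_simp

lemma tendsto_timeScale (ha : 0 < a) (hb : 0 < b) (hp : 0 < p) :
    Tendsto (timeScale a b p) atTop atTop := by
  refine (tendsto_rpow_atTop (one_div_pos.2 ha)).comp ?_
  exact (tendsto_pow_atTop two_ne_zero).atTop_div_const (by positivity)

end TimeScale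

/-- The normalization `c * t ^ g * exp (-y ^ 2 * ψ 1)`, where `t` is the time scale at `y` and
`ψ` is the saddle exponent. -/
def saddleScale (a b g c p y : ℝ) : ℝ :=
  c * timeScale a b p y ^ g * Real.exp (-(y ^ 2 * saddleExponent p 1))

lemma saddleScale_pos {a b g c p y : ℝ} (hb : 0 < b) (hc : 0 < c) (hp : 0 < p) (hy : 0 < y) :
    0 < saddleScale a b g c p y := by
  have := Real.rpow_pos_of_pos (timeScale_pos (a := a) hb hp hy) g
  unfold saddleScale
  positivity

lemma div_saddleScale_eq {a b g c k p y z r : ℝ} (ha : 0 < a) (hb : 0 < b) (hc : 0 < c)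
    (hp : 0 < p) (hk : a * k = p) (hy : 0 < y) (hz : 0 < z) :
    r / saddleScale a b g c p y =
      r / (c * (timeScale a b p y * z ^ (-k)) ^ g *
        Real.exp (-b * (timeScale a b p y * z ^ (-k)) ^ a)) * z ^ (-k * g) *
        Real.exp (-(y ^ 2 * (z ^ (-p) / p - saddleExponent p 1))) := by
  have ht := timeScale_pos (a := a) hb hp hy
  have h1 := mul_timeScale_rpow (y := y) ha hb hp
  set t := timeScale a b p y with htdef
  have hzk : 0 < z ^ (-k) := Real.rpow_pos_of_pos hz _
  have hzkg : 0 < z ^ (-k * g) := Real.rpow_pos_of_pos hz _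
  have htg : 0 < t ^ g := Real.rpow_pos_of_pos ht _
  have h2 : (t * z ^ (-k)) ^ g = t ^ g * z ^ (-k * g) := by
    rw [Real.mul_rpow ht.le hzk.le, ← Real.rpow_mul hz.le]
  have h3 : -b * (t * z ^ (-k)) ^ a = -(y ^ 2 * (z ^ (-p) / p)) := by
    rw [Real.mul_rpow ht.le hzk.le, ← Real.rpow_mul hz.le, show -k * a = -p by linarith,
      ← mul_assoc, neg_mul, h1]
    ring
  rw [h2, h3, saddleScale, ← htdef]
  have h4 : Real.exp (-(y ^ 2 * (z ^ (-p) / p - saddleExponent p 1))) =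
      Real.exp (-(y ^ 2 * (z ^ (-p) / p))) / Real.exp (-(y ^ 2 * saddleExponent p 1)) := by
    rw [← Real.exp_sub]
    ring_nf
  rw [h4]
  field_simp

section Laplace

variable {a b g c k p : ℝ} {G : ℝ → ℝ}

/-- The quotient of a Weibullian tail by the Laplace normalization decays like `exp (-y ^ 2)` far
beyond the time scale. -/
lemma exists_tail_div_saddleScale_le (ha : 0 < a) (hb : 0 < b) (hc : 0 < c) (hp : 0 < p)
    (hk0 : 0 < k) (hk : a * k = p) (hGa : Antitone G)
    (hG : Tendsto (fun t => G t / (c * t ^ g * Real.exp (-b * t ^ a))) atTop (nhds 1)) :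
    ∃ l M : ℝ, 0 < l ∧ l < 1 ∧ 0 < M ∧ ∀ᶠ y in atTop, ∀ z, 0 < z → z ≤ l →
      G (timeScale a b p y * z ^ (-k)) / saddleScale a b g c p y ≤ M * Real.exp (-y ^ 2) := by
  have hψ : saddleExponent p 1 + 1 = 3 / 2 + 1 / p := by rw [saddleExponent_one]; ring
  set A : ℝ := p * (saddleExponent p 1 + 1) with hA
  have hA1 : 1 < A := by
    rw [hA, hψ]
    have : p * (3 / 2 + 1 / p) = p * (3 / 2) + 1 := by field_simp
    rw [this]
    linarith
  have hA0 : 0 < A := by linarith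
  set l : ℝ := A ^ (-(1 / p)) with hl
  have hl0 : 0 < l := Real.rpow_pos_of_pos hA0 _
  have hl1 : l < 1 := Real.rpow_lt_one_of_one_lt_of_neg hA1 (by
    rw [neg_lt_zero]; positivity)
  have hlp : l ^ (-p) / p - saddleExponent p 1 = 1 := by
    rw [hl, ← Real.rpow_mul hA0.le, show -(1 / p) * -p = 1 by field_simp, Real.rpow_one, hA]
    field_simp
    ring
  refine ⟨l, 2 * l ^ (-k * g), hl0, hl1, by positivity, ?_⟩
  have hlk : 0 < l ^ (-k) := Real.rpow_pos_of_pos hl0 _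
  have h1 : Tendsto (fun y => timeScale a b p y * l ^ (-k)) atTop atTop :=
    (tendsto_timeScale ha hb hp).atTop_mul_const hlk
  filter_upwards [(hG.comp h1).eventually (gt_mem_nhds one_lt_two), eventually_gt_atTop 0]
    with y hρ hy z hz hzl
  have ht := timeScale_pos (a := a) hb hp hy
  have h2 : G (timeScale a b p y * z ^ (-k)) ≤ G (timeScale a b p y * l ^ (-k)) := by
    exact hGa (mul_le_mul_of_nonneg_left
      (Real.rpow_le_rpow_of_nonpos hz hzl (by linarith)) ht.le)
  have h3 := saddleScale_pos (a := a) (g := g) hb hc hp hy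
  refine (div_le_div_of_nonneg_right h2 h3.le).trans ?_
  rw [div_saddleScale_eq ha hb hc hp hk hy hl0, hlp, mul_one]
  have h4 : 0 < l ^ (-k * g) := Real.rpow_pos_of_pos hl0 _
  gcongr
  exact hρ.le

lemma eventually_one_le_mul_timeScale_rpow (hb : 0 < b) (hc : 0 < c) (hp : 0 < p) :
    ∀ᶠ y in atTop, 1 ≤ c * timeScale a b p y ^ g * Real.exp (y ^ 2) := by
  have h1 : Tendsto (fun x : ℝ => c * (Real.exp (p * b * x) / x ^ (-(g / a)))) atTop atTop :=
    (tendsto_exp_mul_div_rpow_atTop _ _ (by positivity)).const_mul_atTop hc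
  have h2 : Tendsto (fun y : ℝ => y ^ 2 / (p * b)) atTop atTop :=
    (tendsto_pow_atTop two_ne_zero).atTop_div_const (by positivity)
  filter_upwards [(h1.comp h2).eventually_ge_atTop 1, eventually_gt_atTop 0] with y hy hy0
  refine hy.trans (le_of_eq ?_)
  have hx : 0 < y ^ 2 / (p * b) := by positivity
  rw [Function.comp_apply, timeScale, ← Real.rpow_mul hx.le, Real.rpow_neg hx.le, div_inv_eq_mul,
    mul_div_cancel₀ _ (by positivity : p * b ≠ 0), one_div_mul_eq_div]
  ring

/-- The integrand of the Laplace asymptotics, centered at the saddle point `y`. -/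
def saddleIntegrand (a b p k : ℝ) (G : ℝ → ℝ) (y w : ℝ) : ℝ :=
  Real.exp (-(y + w) ^ 2 / 2) *
    (Ioi 0).indicator (fun x => G (timeScale a b p y * (x / y) ^ (-k))) (y + w)

lemma saddleIntegrand_div_eq (ha : 0 < a) (hb : 0 < b) (hc : 0 < c) (hp : 0 < p)
    (hk : a * k = p) {y w : ℝ} (hy : 0 < y) (hyw : 0 < y + w) :
    saddleIntegrand a b p k G y w / saddleScale a b g c p y =
      G (timeScale a b p y * ((y + w) / y) ^ (-k)) /
        (c * (timeScale a b p y * ((y + w) / y) ^ (-k)) ^ g *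
          Real.exp (-b * (timeScale a b p y * ((y + w) / y) ^ (-k)) ^ a)) *
        ((y + w) / y) ^ (-k * g) *
        Real.exp (-(y ^ 2 * (saddleExponent p ((y + w) / y) - saddleExponent p 1))) := by
  rw [saddleIntegrand, indicator_of_mem (mem_Ioi.2 hyw), mul_div_assoc,
    div_saddleScale_eq ha hb hc hp hk hy (div_pos hyw hy)]
  have h1 : Real.exp (-(y ^ 2 * (saddleExponent p ((y + w) / y) - saddleExponent p 1))) =
      Real.exp (-(y + w) ^ 2 / 2) *
        Real.exp (-(y ^ 2 * (((y + w) / y) ^ (-p) / p - saddleExponent p 1))) := by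
    rw [← Real.exp_add, saddleExponent]
    congr 1
    field_simp
    ring
  rw [h1]
  ring

lemma tendsto_saddleIntegrand_div (ha : 0 < a) (hb : 0 < b) (hc : 0 < c) (hp : 0 < p)
    (hk : a * k = p)
    (hG : Tendsto (fun t => G t / (c * t ^ g * Real.exp (-b * t ^ a))) atTop (nhds 1)) (w : ℝ) :
    Tendsto (fun y => saddleIntegrand a b p k G y w / saddleScale a b g c p y) atTop
      (nhds (Real.exp (-((p + 2) / 2) * w ^ 2))) := by
  have hz : Tendsto (fun y : ℝ => (y + w) / y) atTop (nhds 1) := by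
    have h1 : Tendsto (fun y : ℝ => 1 + w / y) atTop (nhds (1 + 0)) :=
      tendsto_const_nhds.add (tendsto_const_nhds.div_atTop tendsto_id)
    rw [add_zero] at h1
    refine h1.congr' ?_
    filter_upwards [eventually_gt_atTop 0] with y hy
    field_simp
  have hpow : ∀ q : ℝ, Tendsto (fun y : ℝ => ((y + w) / y) ^ q) atTop (nhds 1) := by
    intro q
    have := (Real.continuousAt_rpow_const 1 q (Or.inl one_ne_zero)).tendsto.comp hz
    rwa [Real.one_rpow] at this
  have ht : Tendsto (fun y => timeScale a b p y * ((y + w) / y) ^ (-k)) atTop atTop :=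
    (tendsto_timeScale ha hb hp).atTop_mul_pos one_pos (hpow _)
  have hexp := (Real.continuous_exp.tendsto _).comp (tendsto_sq_mul_saddleExponent_sub hp w).neg
  have h := ((hG.comp ht).mul (hpow (-k * g))).mul hexp
  rw [one_mul, one_mul, show -((p + 2) * w ^ 2 / 2) = -((p + 2) / 2) * w ^ 2 by ring] at h
  refine h.congr' ?_
  filter_upwards [eventually_gt_atTop 0, eventually_gt_atTop (-w)] with y hy hyw
  rw [saddleIntegrand_div_eq ha hb hc hp hk hy (by linarith)]
  rfl

lemma exists_saddleIntegrand_div_le (ha : 0 < a) (hb : 0 < b) (hc : 0 < c) (hp : 0 < p)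
    (hk0 : 0 < k) (hk : a * k = p) (hGa : Antitone G) (hG0 : ∀ t, 0 ≤ G t) (hG1 : ∀ t, G t ≤ 1)
    (hG : Tendsto (fun t => G t / (c * t ^ g * Real.exp (-b * t ^ a))) atTop (nhds 1)) :
    ∃ M : ℝ, ∀ᶠ y in atTop, ∀ w,
      ‖saddleIntegrand a b p k G y w / saddleScale a b g c p y‖ ≤
        M * Real.exp (-(1 / 4) * w ^ 2) := by
  obtain ⟨l, M₁, hl0, hl1, hM₁, hsmall⟩ :=
    exists_tail_div_saddleScale_le ha hb hc hp hk0 hk hGa hG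
  have hψ0 : 0 < saddleExponent p 1 := by rw [saddleExponent_one]; positivity
  set L : ℝ := 4 * (saddleExponent p 1 + 1) with hL
  have hL1 : 1 < L := by linarith
  have hL0 : 0 < L := by linarith
  obtain ⟨M₂, hM₂⟩ := (isCompact_Icc (a := l) (b := L)).exists_bound_of_continuousOn
    (f := fun z => z ^ (-k * g)) (fun z hz =>
      (Real.continuousAt_rpow_const _ _ (Or.inl (hl0.trans_le hz.1).ne')).continuousWithinAt)
  have hLk : 0 < L ^ (-k) := Real.rpow_pos_of_pos hL0 _
  obtain ⟨t₀, ht₀⟩ := eventually_atTop.1 (hG.eventually (gt_mem_nhds one_lt_two))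
  have hlarge : Tendsto (fun y => timeScale a b p y * L ^ (-k)) atTop atTop :=
    (tendsto_timeScale ha hb hp).atTop_mul_const hLk
  have hM₂0 : 0 ≤ M₂ := (norm_nonneg _).trans (hM₂ l ⟨le_rfl, by linarith⟩)
  refine ⟨M₁ + 2 * M₂ + 1, ?_⟩
  filter_upwards [hsmall, hlarge.eventually_ge_atTop t₀, eventually_gt_atTop 0,
    eventually_one_le_mul_timeScale_rpow (a := a) (g := g) hb hc hp] with y hsmall ht hy hone w
  have hD := saddleScale_pos (a := a) (g := g) hb hc hp hy
  have hτ := timeScale_pos (a := a) hb hp hy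
  have hnn : 0 ≤ saddleIntegrand a b p k G y w :=
    mul_nonneg (Real.exp_nonneg _) (indicator_nonneg (fun _ _ => hG0 _) _)
  rw [Real.norm_of_nonneg (div_nonneg hnn hD.le)]
  have hE := Real.exp_pos (-(1 / 4) * w ^ 2)
  rcases le_or_gt (y + w) 0 with hyw | hyw
  · rw [saddleIntegrand, indicator_of_notMem (by simpa using hyw), mul_zero, zero_div]
    positivity
  have hz := div_pos hyw hy
  rcases le_or_gt ((y + w) / y) l with hzl | hzl
  · have h1 : saddleIntegrand a b p k G y w ≤
        G (timeScale a b p y * ((y + w) / y) ^ (-k)) := by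
      rw [saddleIntegrand, indicator_of_mem (mem_Ioi.2 hyw)]
      refine mul_le_of_le_one_left (hG0 _) (Real.exp_le_one_iff.2 ?_)
      nlinarith [sq_nonneg (y + w)]
    have h2 : Real.exp (-y ^ 2) ≤ Real.exp (-(1 / 4) * w ^ 2) := by
      rw [Real.exp_le_exp]
      have : w ≤ 0 := by
        have := (div_le_iff₀ hy).1 hzl
        nlinarith
      nlinarith
    calc _ ≤ _ := div_le_div_of_nonneg_right h1 hD.le
      _ ≤ M₁ * Real.exp (-y ^ 2) := hsmall _ hz hzl
      _ ≤ M₁ * Real.exp (-(1 / 4) * w ^ 2) := by gcongr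
      _ ≤ _ := by gcongr; linarith
  rcases le_or_gt ((y + w) / y) L with hzL | hzL
  · rw [saddleIntegrand_div_eq ha hb hc hp hk hy hyw]
    have h1 : t₀ ≤ timeScale a b p y * ((y + w) / y) ^ (-k) := by
      exact ht.trans (mul_le_mul_of_nonneg_left
        (Real.rpow_le_rpow_of_nonpos hz hzL (by linarith)) hτ.le)
    have h2 := (ht₀ _ h1).le
    have h3 : ((y + w) / y) ^ (-k * g) ≤ M₂ :=
      (le_abs_self _).trans (hM₂ _ ⟨hzl.le, hzL⟩)
    have h4 : Real.exp (-(y ^ 2 * (saddleExponent p ((y + w) / y) - saddleExponent p 1))) ≤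
        Real.exp (-(1 / 4) * w ^ 2) := by
      rw [Real.exp_le_exp]
      have h5 := mul_le_mul_of_nonneg_left (saddleExponent_sub_ge hp hz) (sq_nonneg y)
      have h6 : y ^ 2 * (((y + w) / y - 1) ^ 2 / 2) = w ^ 2 / 2 := by field_simp; ring
      nlinarith [sq_nonneg w]
    calc _ ≤ 2 * M₂ * Real.exp (-(1 / 4) * w ^ 2) := by
          have h7 := Real.rpow_pos_of_pos hz (-k * g)
          gcongr
      _ ≤ _ := by gcongr; linarith
  · have h1 : saddleIntegrand a b p k G y w ≤ Real.exp (-(y + w) ^ 2 / 2) := by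
      rw [saddleIntegrand, indicator_of_mem (mem_Ioi.2 hyw)]
      exact mul_le_of_le_one_right (Real.exp_nonneg _) (hG1 _)
    refine (div_le_div_of_nonneg_right h1 hD.le).trans ?_
    rw [div_le_iff₀ hD]
    have h2 : L * y ≤ y + w := ((lt_div_iff₀ hy).1 hzL).le
    have h3 : Real.exp (-(y + w) ^ 2 / 2) ≤
        Real.exp (-(1 / 4) * w ^ 2) * Real.exp (-(y ^ 2 * saddleExponent p 1)) *
          Real.exp (-y ^ 2) := by
      rw [← Real.exp_add, ← Real.exp_add, Real.exp_le_exp]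
      have hw : 0 ≤ w := by nlinarith
      have h4 : (L * y) ^ 2 ≤ (y + w) ^ 2 := pow_le_pow_left₀ (by positivity) h2 2
      have h5 : L * y ^ 2 ≤ (L * y) ^ 2 := by nlinarith [sq_nonneg y]
      have h6 : w ^ 2 ≤ (y + w) ^ 2 := pow_le_pow_left₀ hw (by linarith) 2
      rw [hL] at h5
      linarith
    refine h3.trans ?_
    have h7 : Real.exp (-y ^ 2) ≤ c * timeScale a b p y ^ g := by
      rw [Real.exp_neg, inv_le_iff_one_le_mul₀ (Real.exp_pos _)]
      exact hone
    rw [saddleScale]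
    calc _ ≤ Real.exp (-(1 / 4) * w ^ 2) * Real.exp (-(y ^ 2 * saddleExponent p 1)) *
          (c * timeScale a b p y ^ g) := by gcongr
      _ = 1 * Real.exp (-(1 / 4) * w ^ 2) *
          (c * timeScale a b p y ^ g * Real.exp (-(y ^ 2 * saddleExponent p 1))) := by ring
      _ ≤ _ := by
        have := Real.rpow_pos_of_pos hτ g
        gcongr
        linarith

lemma tendsto_integral_saddleIntegrand (ha : 0 < a) (hb : 0 < b) (hc : 0 < c) (hp : 0 < p)
    (hk0 : 0 < k) (hk : a * k = p) (hGa : Antitone G) (hG0 : ∀ t, 0 ≤ G t) (hG1 : ∀ t, G t ≤ 1)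
    (hG : Tendsto (fun t => G t / (c * t ^ g * Real.exp (-b * t ^ a))) atTop (nhds 1)) :
    Tendsto (fun y => (∫ w, saddleIntegrand a b p k G y w) / saddleScale a b g c p y) atTop
      (nhds (Real.sqrt (Real.pi / ((p + 2) / 2)))) := by
  obtain ⟨M, hM⟩ := exists_saddleIntegrand_div_le ha hb hc hp hk0 hk hGa hG0 hG1 hG
  rw [← integral_gaussian]
  simp_rw [← integral_div]
  refine tendsto_integral_filter_of_dominated_convergence
    (fun w => M * Real.exp (-(1 / 4) * w ^ 2)) ?_ ?_ ?_ ?_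
  · refine Eventually.of_forall fun y => Measurable.aestronglyMeasurable ?_
    have hGm : Measurable G := hGa.measurable
    have h1 : Measurable fun x : ℝ =>
        (Ioi (0 : ℝ)).indicator (fun x => G (timeScale a b p y * (x / y) ^ (-k))) x :=
      Measurable.indicator (hGm.comp (by fun_prop)) measurableSet_Ioi
    have h2 : Measurable fun w : ℝ => y + w := by fun_prop
    refine Measurable.div_const (Measurable.mul (by fun_prop) (h1.comp h2)) _
  · filter_upwards [hM] with y hy
    exact Eventually.of_forall hy
  · exact (integrable_exp_neg_mul_sq (by norm_num)).const_mul M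
  · exact Eventually.of_forall fun w => tendsto_saddleIntegrand_div ha hb hc hp hk hG w

end Laplace

lemma antitone_measure_Ioi (ν : Measure ℝ) : Antitone fun t => ν (Ioi t) :=
  fun _ _ hst => measure_mono (Ioi_subset_Ioi hst)

section RandomTime

variable {a b c g H x y : ℝ} {ν : Measure ℝ}

lemma level_div_rpow_eq (hb : 0 < b) (ha : 0 < a) (hH : 0 < H) (hx : 0 < x) (hy : 0 < y) :
    (y * timeScale a b (a / H) y ^ H / x) ^ (1 / H) =
      timeScale a b (a / H) y * (x / y) ^ (-(1 / H)) := by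
  have ht := timeScale_pos (a := a) hb (div_pos ha hH) hy
  rw [Real.rpow_neg (by positivity), ← Real.inv_rpow (by positivity), inv_div,
    mul_comm y, mul_div_assoc, Real.mul_rpow (by positivity) (by positivity), ← Real.rpow_mul ht.le,
    mul_one_div_cancel hH.ne', Real.rpow_one]

lemma toReal_productTail_eq [IsProbabilityMeasure ν] (hb : 0 < b) (ha : 0 < a) (hH : 0 < H)
    (hy : 0 < y) :
    (productTail ν H (y * timeScale a b (a / H) y ^ H)).toReal =
      (Real.sqrt (2 * Real.pi))⁻¹ *
        ∫ w, saddleIntegrand a b (a / H) (1 / H) (fun t => (ν (Ioi t)).toReal) y w := by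
  have hm : Measurable fun x : ℝ => (Ioi 0).indicator
      (fun x => ν (Ioi ((y * timeScale a b (a / H) y ^ H / x) ^ (1 / H)))) x :=
    Measurable.indicator ((antitone_measure_Ioi ν).measurable.comp
      (by fun_prop : Measurable fun x : ℝ =>
        (y * timeScale a b (a / H) y ^ H / x) ^ (1 / H))) measurableSet_Ioi
  have hfin : ∀ x : ℝ, (Ioi 0).indicator
      (fun x => ν (Ioi ((y * timeScale a b (a / H) y ^ H / x) ^ (1 / H)))) x < ⊤ := by
    intro x
    by_cases hx : x ∈ Ioi (0 : ℝ)
    · rw [indicator_of_mem hx]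
      exact measure_lt_top _ _
    · rw [indicator_of_notMem hx]
      exact ENNReal.zero_lt_top
  rw [productTail, ← integral_toReal hm.aemeasurable (Eventually.of_forall hfin),
    integral_gaussianReal_eq_integral_smul one_ne_zero, ← integral_const_mul,
    ← integral_add_left_eq_self _ y]
  refine integral_congr_ae (Eventually.of_forall fun w => ?_)
  simp only [gaussianPDFReal, saddleIntegrand, smul_eq_mul, NNReal.coe_one, mul_one, sub_zero,
    mul_assoc]
  congr 2
  by_cases hw : y + w ∈ Ioi (0 : ℝ)
  · rw [indicator_of_mem hw, indicator_of_mem hw, level_div_rpow_eq hb ha hH hw hy]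
  · rw [indicator_of_notMem hw, indicator_of_notMem hw, ENNReal.toReal_zero]

/-- Exact asymptotics of the upper tail of `N T ^ H`, along the levels with saddle point `y`. -/
lemma tendsto_productTail_div (hb : 0 < b) (ha : 0 < a) (hc : 0 < c) (hH : 0 < H)
    [IsProbabilityMeasure ν]
    (hν : Tendsto (fun t => (ν (Ioi t)).toReal / (c * t ^ g * Real.exp (-b * t ^ a))) atTop
      (nhds 1)) :
    Tendsto (fun y => (productTail ν H (y * timeScale a b (a / H) y ^ H)).toReal /
      (saddleScale a b g c (a / H) y / Real.sqrt (a / H + 2))) atTop (nhds 1) := by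
  have hp : 0 < a / H := div_pos ha hH
  have h := (tendsto_integral_saddleIntegrand (k := 1 / H) ha hb hc hp (one_div_pos.2 hH)
    (by ring) (fun _ _ hst => ENNReal.toReal_mono (measure_ne_top _ _)
      (antitone_measure_Ioi ν hst)) (fun _ => ENNReal.toReal_nonneg)
    (fun _ => ENNReal.toReal_le_of_le_ofReal zero_le_one (by simpa using prob_le_one)) hν).const_mul
    ((Real.sqrt (2 * Real.pi))⁻¹ * Real.sqrt (a / H + 2))
  have h1 : (Real.sqrt (2 * Real.pi))⁻¹ * Real.sqrt (a / H + 2) *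
      Real.sqrt (Real.pi / ((a / H + 2) / 2)) = 1 := by
    rw [← Real.sqrt_inv, ← Real.sqrt_mul (by positivity), ← Real.sqrt_mul (by positivity),
      Real.sqrt_eq_one]
    have := Real.pi_pos
    field_simp
  rw [h1] at h
  refine h.congr' ?_
  filter_upwards [eventually_gt_atTop 0] with y hy
  rw [toReal_productTail_eq hb ha hH hy]
  have := saddleScale_pos (a := a) (g := g) hb hc hp hy
  have := Real.sqrt_pos.2 (by positivity : 0 < a / H + 2)
  field_simp

lemma tendsto_tail_div_zero (hb : 0 < b) (ha : 0 < a) (hc : 0 < c) (hH : 0 < H) (hx : 0 < x)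
    [IsProbabilityMeasure ν]
    (hν : Tendsto (fun t => (ν (Ioi t)).toReal / (c * t ^ g * Real.exp (-b * t ^ a))) atTop
      (nhds 1)) :
    Tendsto (fun y => (ν (Ioi ((y * timeScale a b (a / H) y ^ H / x) ^ (1 / H)))).toReal /
      (saddleScale a b g c (a / H) y / Real.sqrt (a / H + 2))) atTop (nhds 0) := by
  have hp : 0 < a / H := div_pos ha hH
  obtain ⟨l, M, hl0, -, -, h⟩ := exists_tail_div_saddleScale_le (k := 1 / H) ha hb hc hp
    (one_div_pos.2 hH) (by ring) (fun _ _ hst => ENNReal.toReal_mono (measure_ne_top _ _)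
      (antitone_measure_Ioi ν hst)) hν
  have hsq := Real.sqrt_pos.2 (by positivity : 0 < a / H + 2)
  have hlim : Tendsto (fun y : ℝ => Real.sqrt (a / H + 2) * (M * Real.exp (-y ^ 2))) atTop
      (nhds 0) := by
    have h1 : Tendsto (fun y : ℝ => Real.exp (-y ^ 2)) atTop (nhds 0) :=
      Real.tendsto_exp_neg_atTop_nhds_zero.comp (tendsto_pow_atTop two_ne_zero)
    simpa using (h1.const_mul M).const_mul (Real.sqrt (a / H + 2))
  refine tendsto_of_tendsto_of_tendsto_of_le_of_le' tendsto_const_nhds hlim ?_ ?_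
  · filter_upwards [eventually_gt_atTop 0] with y hy
    have := saddleScale_pos (a := a) (g := g) hb hc hp hy
    positivity
  · filter_upwards [h, eventually_gt_atTop 0, eventually_ge_atTop (x / l)] with y hy hy0 hyx
    rw [level_div_rpow_eq hb ha hH hx hy0, div_div_eq_mul_div, mul_div_right_comm, mul_comm]
    gcongr
    exact hy _ (div_pos hx hy0) ((div_le_comm₀ hl0 hy0).1 hyx)

end RandomTime

/-- The saddle point at level `u`. -/
def saddlePoint (b p u : ℝ) : ℝ := (b * p * u ^ p) ^ (1 / (p + 2))

lemma tendsto_saddlePoint {b p : ℝ} (hb : 0 < b) (hp : 0 < p) :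
    Tendsto (saddlePoint b p) atTop atTop :=
  (tendsto_rpow_atTop (by positivity)).comp
    ((tendsto_rpow_atTop hp).const_mul_atTop (by positivity))

lemma saddlePoint_mul_timeScale {a b H u : ℝ} (ha : 0 < a) (hb : 0 < b) (hH : 0 < H)
    (hu : 0 < u) :
    saddlePoint b (a / H) u * timeScale a b (a / H) (saddlePoint b (a / H) u) ^ H = u := by
  have hp : 0 < a / H := div_pos ha hH
  set p := a / H with hpdef
  have hup : 0 < u ^ p := Real.rpow_pos_of_pos hu _
  set q := b * p * u ^ p with hq
  have hq0 : 0 < q := by positivity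
  set y := saddlePoint b p u with hy
  have hy0 : 0 < y := Real.rpow_pos_of_pos hq0 _
  have hyp : y ^ (p + 2) = q := by
    rw [hy, saddlePoint, ← hq, ← Real.rpow_mul hq0.le, one_div_mul_cancel (by positivity),
      Real.rpow_one]
  have hH' : 1 / a * H = 1 / p := by rw [hpdef]; field_simp
  rw [timeScale, ← Real.rpow_mul (by positivity), hH']
  refine (Real.rpow_left_inj (by positivity) hu.le hp.ne').1 ?_
  rw [Real.mul_rpow (by positivity) (by positivity), ← Real.rpow_mul (by positivity),
    one_div_mul_cancel hp.ne', Real.rpow_one]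
  rw [Real.rpow_add hy0, Real.rpow_two] at hyp
  have h1 : y ^ p * (y ^ 2 / (p * b)) = q / (p * b) := by rw [← hyp]; ring
  rw [h1, hq]
  field_simp

lemma saddleScale_saddlePoint {a b g c H u : ℝ} (ha : 0 < a) (hb : 0 < b) (hH : 0 < H)
    (hu : 0 < u) :
    saddleScale a b g c (a / H) (saddlePoint b (a / H) u) / Real.sqrt (a / H + 2) =
      c * Real.sqrt H / Real.sqrt (a + 2 * H) * (H / (a * b)) ^ (g / (a + 2 * H)) *
        u ^ (2 * g / (a + 2 * H)) *
        Real.exp (-(b ^ (2 * H / (2 * H + a)) *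
          ((1 / 2) * (a / H) ^ (2 * H / (2 * H + a)) + (a / H) ^ (-a / (2 * H + a)))) *
          u ^ (2 * a / (2 * H + a))) := by
  have hp : 0 < a / H := div_pos ha hH
  set p := a / H with hpdef
  have hap : a = p * H := by rw [hpdef]; field_simp
  have hup : 0 < u ^ p := Real.rpow_pos_of_pos hu _
  have hq0 : 0 < b * p * u ^ p := by positivity
  set y := saddlePoint b p u with hy
  have hsq : Real.sqrt (p + 2) = Real.sqrt (a + 2 * H) / Real.sqrt H := by
    rw [← Real.sqrt_div (by positivity), hap]
    congr 1
    field_simp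
  have hy2 : y ^ 2 = b ^ (2 * H / (2 * H + a)) * p ^ (2 * H / (2 * H + a)) *
      u ^ (2 * a / (2 * H + a)) := by
    rw [hy, saddlePoint, ← Real.rpow_natCast, ← Real.rpow_mul hq0.le,
      Real.mul_rpow (by positivity) hup.le, Real.mul_rpow hb.le hp.le, ← Real.rpow_mul hu.le]
    have h1 : 1 / (p + 2) * ((2 : ℕ) : ℝ) = 2 * H / (2 * H + a) := by
      rw [hap]; push_cast; field_simp; ring
    have h2 : p * (2 * H / (2 * H + a)) = 2 * a / (2 * H + a) := by
      rw [hap]; field_simp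
    rw [h1, h2]
  have hexp : y ^ 2 * saddleExponent p 1 = b ^ (2 * H / (2 * H + a)) *
      ((1 / 2) * p ^ (2 * H / (2 * H + a)) + p ^ (-a / (2 * H + a))) *
        u ^ (2 * a / (2 * H + a)) := by
    have h1 : p ^ (-a / (2 * H + a)) = p ^ (2 * H / (2 * H + a)) / p := by
      rw [← Real.rpow_sub_one hp.ne']
      congr 1
      field_simp
      ring
    rw [hy2, saddleExponent_one, h1]
    ring
  have ht : timeScale a b p y ^ g = (H / (a * b)) ^ (g / (a + 2 * H)) *
      u ^ (2 * g / (a + 2 * H)) := by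
    have hpb : 0 < H / (a * b) := by positivity
    have h1 : y ^ 2 / (p * b) = ((H / (a * b)) * u ^ (2 : ℝ)) ^ (a / (a + 2 * H)) := by
      rw [hy2, Real.mul_rpow hpb.le (by positivity), ← Real.rpow_mul hu.le,
        ← Real.mul_rpow hb.le hp.le]
      have h2 : H / (a * b) = (b * p)⁻¹ := by rw [hpdef]; field_simp
      have h3 : 2 * H / (2 * H + a) = 1 + -(a / (a + 2 * H)) := by field_simp; ring
      have h4 : 2 * a / (2 * H + a) = 2 * (a / (a + 2 * H)) := by
        rw [add_comm (2 * H), mul_div_assoc]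
      rw [h2, h3, h4, Real.rpow_add (by positivity), Real.rpow_one, Real.rpow_neg (by positivity),
        Real.inv_rpow (by positivity)]
      field_simp
    rw [timeScale, h1, ← Real.rpow_mul (by positivity), ← Real.rpow_mul (by positivity),
      show a / (a + 2 * H) * (1 / a * g) = g / (a + 2 * H) by field_simp,
      Real.mul_rpow hpb.le (by positivity), ← Real.rpow_mul hu.le, mul_div_assoc]
  have := Real.sqrt_pos.2 hH
  rw [saddleScale, ht, hexp, hsq]
  field_simp

lemma tendsto_one_of_forall_bounds {ι : Type*} {l : Filter ι} {E I : ι → ℝ}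
    (hI : Tendsto I l (nhds 1)) (hle : ∀ᶠ i in l, I i ≤ E i)
    (hge : ∀ ε : ℝ, 0 < ε → ∃ R : ι → ℝ, Tendsto R l (nhds 0) ∧
      ∀ᶠ i in l, E i ≤ (1 + ε) * I i + R i) : Tendsto E l (nhds 1) := by
  refine tendsto_order.2 ⟨fun m hm => ?_, fun m hm => ?_⟩
  · filter_upwards [hI.eventually (lt_mem_nhds hm), hle] with i h1 h2
    exact h1.trans_le h2
  · obtain ⟨R, hR, h⟩ := hge ((m - 1) / 2) (by linarith)
    have h1 := (hI.const_mul (1 + (m - 1) / 2)).add hR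
    filter_upwards [h1.eventually (gt_mem_nhds (by linarith : _ < m)), h] with i h2 h3
    exact h3.trans_lt h2

/-- Theorem 4.1 (iii): for fBm with Hurst parameter `H ∈ (1/2, 1]` and an independent
Weibullian time `T`, the supremum `sup_{[0,T]} B_H` is asymptotically Weibullian. -/
theorem sup_fbm_weibullian_time_high_hurst {Ω : Type*} [MeasurableSpace Ω]
    (P : Measure Ω) [IsProbabilityMeasure P]
    (H : ℝ) (hH : H ∈ Set.Ioc (1 / 2 : ℝ) 1)
    (B : ℝ → Ω → ℝ) (hB : IsFBM P H B)
    (T : Ω → ℝ) (hTm : Measurable T) (hTnn : ∀ ω, 0 ≤ T ω)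
    (α β γ C : ℝ) (hα : 0 < α) (hβ : 0 < β) (hC : 0 < C)
    (hTW : MemW P T α β γ C)
    (hInd : Indep (MeasurableSpace.comap T inferInstance)
      (⨆ t ∈ Set.Ici (0 : ℝ), MeasurableSpace.comap (B t) inferInstance) P) :
    MemW P (fun ω => sSup ((fun s => B s ω) '' Set.Icc 0 (T ω)))
      (2 * α / (2 * H + α))
      (β ^ (2 * H / (2 * H + α)) *
        ((1 / 2) * (α / H) ^ (2 * H / (2 * H + α)) + (α / H) ^ (-α / (2 * H + α))))
      (2 * γ / (α + 2 * H))
      (C * Real.sqrt H / Real.sqrt (α + 2 * H) * (H / (α * β)) ^ (γ / (α + 2 * H))) := by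
  have hH0 : 0 < H := by linarith [hH.1]
  have hp : 0 < α / H := div_pos hα hH0
  have : IsProbabilityMeasure (P.map T) := Measure.isProbabilityMeasure_map hTm.aemeasurable
  have hν : Tendsto (fun t => ((P.map T) (Set.Ioi t)).toReal /
      (C * t ^ γ * Real.exp (-β * t ^ α))) atTop (nhds 1) := by
    refine hTW.congr fun t => ?_
    rw [Measure.map_apply hTm measurableSet_Ioi]
    rfl
  have hy := tendsto_saddlePoint (b := β) hβ hp
  set D : ℝ → ℝ := fun u =>
    saddleScale α β γ C (α / H) (saddlePoint β (α / H) u) / Real.sqrt (α / H + 2) with hD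
  have hD0 : ∀ u, 0 < u → 0 < D u := by
    intro u hu
    refine div_pos (saddleScale_pos hβ hC hp ?_) (Real.sqrt_pos.2 (by positivity))
    exact Real.rpow_pos_of_pos (by positivity) _
  have key : Tendsto (fun u => (P {ω | u < sSup ((fun s => B s ω) '' Set.Icc 0 (T ω))}).toReal /
      D u) atTop (nhds 1) := by
    have hI : Tendsto (fun u => (productTail (P.map T) H u).toReal / D u) atTop (nhds 1) := by
      refine ((tendsto_productTail_div hβ hα hC hH0 hν).comp hy).congr' ?_
      filter_upwards [eventually_gt_atTop 0] with u hu
      rw [Function.comp_apply, saddlePoint_mul_timeScale hα hβ hH0 hu]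
    refine tendsto_one_of_forall_bounds hI ?_ fun ε hε => ?_
    · obtain ⟨x₀, -, hb⟩ := hB.measure_sSup_bounds hH.1 hTm hTnn hInd one_pos
      filter_upwards [eventually_gt_atTop 0] with u hu
      exact div_le_div_of_nonneg_right
        (ENNReal.toReal_mono (measure_ne_top _ _) (hb u hu).1) (hD0 u hu).le
    · obtain ⟨x₀, hx₀, hb⟩ := hB.measure_sSup_bounds hH.1 hTm hTnn hInd hε
      refine ⟨fun u => ((P.map T) (Set.Ioi ((u / x₀) ^ (1 / H)))).toReal / D u, ?_, ?_⟩
      · refine ((tendsto_tail_div_zero hβ hα hC hH0 hx₀ hν).comp hy).congr' ?_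
        filter_upwards [eventually_gt_atTop 0] with u hu
        rw [Function.comp_apply, saddlePoint_mul_timeScale hα hβ hH0 hu]
      · filter_upwards [eventually_gt_atTop 0] with u hu
        have hfin : productTail (P.map T) H u ≠ ⊤ :=
          ne_top_of_le_ne_top (measure_ne_top _ _) (hb u hu).1
        have h1 := ENNReal.toReal_mono (ENNReal.add_ne_top.2
          ⟨ENNReal.mul_ne_top ENNReal.ofReal_ne_top hfin, measure_ne_top _ _⟩) (hb u hu).2
        rw [ENNReal.toReal_add (ENNReal.mul_ne_top ENNReal.ofReal_ne_top hfin)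
          (measure_ne_top _ _), ENNReal.toReal_mul, ENNReal.toReal_ofReal (by positivity)] at h1
        rw [← mul_div_assoc, ← add_div]
        exact div_le_div_of_nonneg_right h1 (hD0 u hu).le
  refine key.congr' ?_
  filter_upwards [eventually_gt_atTop 0] with u hu
  simp only [hD]
  rw [saddleScale_saddlePoint hα hβ hH0 hu]
end
end

section
/- Let {B_H(s) : s ≥ 0} be a fractional Brownian motion with Hurst parameter H = 1/2 (i.e. a standard Brownian motion) and let T ∈ W(α, β, γ, C) be a nonnegative random variable independent of {B_H(s)}. Then sup_{s ∈ [0,T]} B_H(s) ∈ W( 2α/(2H + α), β₁, 2γ/(α + 2H), 2C₂ ), where β₁ = β^{2H/(2H+α)} ( (1/2)(α/H)^{2H/(2H+α)} + (α/H)^{−α/(2H+α)} ) and C₂ = (C√H/√(α+2H)) (H/(αβ))^{γ/(α+2H)} (with H = 1/2). -/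
open MeasureTheory ProbabilityTheory Filter Set

noncomputable section

section

open scoped NNReal ENNReal Topology

variable {Ω : Type*} [MeasurableSpace Ω] {P : Measure Ω}

lemma fbmCov_half {s t : ℝ} : fbmCov (1 / 2) s t = (s + t - |t - s|) / 2 := by
  simp [fbmCov]

lemma IsCenteredGaussianCov.isGaussianProcess {X : ℝ → Ω → ℝ} {K : ℝ → ℝ → ℝ}
    (hX : IsCenteredGaussianCov P X K) :
    IsGaussianProcess (fun (t : ℝ≥0) => X t) P where
  hasGaussianLaw I := by
    refine ⟨isGaussian_of_map_eq_gaussianReal fun L => ?_⟩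
    have hm : Measurable fun ω => I.restrict (fun t : ℝ≥0 => X t ω) :=
      measurable_pi_lambda _ fun i => hX.1 _
    rw [Measure.map_map L.continuous.measurable hm]
    obtain ⟨v, -, hv⟩ := hX.2 I.card (fun i => ((I.equivFin.symm i : ℝ≥0) : ℝ))
      (fun i => L (Pi.single (I.equivFin.symm i) 1)) (fun i => NNReal.coe_nonneg _)
    refine ⟨0, v, ?_⟩
    rw [← hv]
    congr 1
    ext ω
    rw [← I.equivFin.sum_comp]
    simp only [Equiv.symm_apply_apply, Function.comp_apply]
    conv_lhs => rw [← LinearMap.sum_single_apply _ (I.restrict fun t : ℝ≥0 => X t ω)]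
    rw [map_sum]
    refine Finset.sum_congr rfl fun i _ => ?_
    have : (Pi.single i (I.restrict (fun t : ℝ≥0 => X t ω) i) : I → ℝ)
        = (X i ω) • Pi.single i (1 : ℝ) := by
      rw [← Pi.single_smul]; simp
    rw [this, map_smul, smul_eq_mul, mul_comm]

lemma IsCenteredGaussianCov.hasLaw_eval {X : ℝ → Ω → ℝ}
    (hX : IsCenteredGaussianCov P X (fbmCov (1 / 2))) (t : ℝ≥0) :
    HasLaw (X t) (gaussianReal 0 t) P := by
  obtain ⟨v, hv, h⟩ := hX.2 1 (fun _ => t) (fun _ => 1) (fun _ => t.2)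
  simp only [fbmCov_half, Finset.univ_unique, Finset.sum_singleton] at hv h
  refine ⟨(hX.1 _).aemeasurable, ?_⟩
  have : v = t := by
    apply NNReal.eq
    rw [hv]; simp
  simpa [this] using h

lemma IsCenteredGaussianCov.isPreBrownianReal {X : ℝ → Ω → ℝ}
    (hX : IsCenteredGaussianCov P X (fbmCov (1 / 2))) :
    IsPreBrownianReal (fun (t : ℝ≥0) => X t) P := by
  have hG := hX.isGaussianProcess
  have := hG.isProbabilityMeasure
  refine hG.isPreBrownianReal_of_covariance (fun t => ?_) fun s t hst => ?_
  · rw [(hX.hasLaw_eval t).integral_eq, integral_id_gaussianReal]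
  · obtain ⟨v, hv, h⟩ := hX.2 2 ![(s : ℝ), t] ![1, 1] (by intro i; fin_cases i <;> simp)
    have hst' : (s : ℝ) ≤ t := hst
    simp only [fbmCov_half, Fin.sum_univ_two, Matrix.cons_val_zero, Matrix.cons_val_one,
      one_mul] at hv h
    rw [abs_of_nonneg (sub_nonneg.2 hst'), abs_of_nonpos (sub_nonpos.2 hst')] at hv
    have hL : HasLaw (X s + X t) (gaussianReal 0 v) P :=
      ⟨((hX.1 _).add (hX.1 _)).aemeasurable, h⟩
    have hvar : Var[X s + X t; P] = v := by
      rw [hL.variance_eq, variance_id_gaussianReal]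
    rw [variance_add (hG.hasGaussianLaw_eval s).memLp_two (hG.hasGaussianLaw_eval t).memLp_two,
      (hX.hasLaw_eval s).variance_eq, (hX.hasLaw_eval t).variance_eq,
      variance_id_gaussianReal, variance_id_gaussianReal, hv] at hvar
    simp at hvar
    linarith

lemma measure_inter_reflect [IsProbabilityMeasure P] {X : ℝ≥0 → Ω → ℝ}
    (hX : IsPreBrownianReal X P) (hm : ∀ t, Measurable (X t)) {s : ℕ → ℝ≥0} (hs : Monotone s)
    {t : ℝ≥0} {k : ℕ} (hk : s k ≤ t) (u : ℝ) :
    P {ω | (u < X (s k) ω ∧ ∀ j < k, X (s j) ω ≤ u) ∧ X t ω ≤ u} =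
      P {ω | (u < X (s k) ω ∧ ∀ j < k, X (s j) ω ≤ u) ∧ 2 * X (s k) ω - u ≤ X t ω} := by
  have hind := hX.indepFun_shift (s k)
  let V : Ω → ℕ → ℝ := fun ω j => X (s (min j k)) ω
  let W : Ω → ℝ := fun ω => X t ω - X (s k) ω
  have hV : Measurable V := measurable_pi_lambda _ fun _ => hm _
  have hW : Measurable W := (hm _).sub (hm _)
  have hVW : IndepFun V W P := by
    have hφ : Measurable fun (v : Set.Iic (s k) → ℝ) (j : ℕ) =>
        v ⟨s (min j k), hs (min_le_right _ _)⟩ :=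
      measurable_pi_lambda _ fun _ => measurable_pi_apply _
    have hψ : Measurable fun v : ℝ≥0 → ℝ => v (t - s k) := measurable_pi_apply _
    have := hind.symm.comp hφ hψ
    convert this using 1
    · rfl
    · ext ω
      simp [W, add_tsub_cancel_of_le hk]
  have hVW' : IndepFun V (-W) P := hVW.comp measurable_id measurable_neg
  have hneg : P.map (-W) = P.map W := by
    have h := hX.hasLaw_sub t (s k)
    have h' := gaussianReal_neg h
    rw [neg_zero] at h'
    exact h'.map_eq.trans h.map_eq.symm
  have key : P.map (fun ω => (V ω, W ω)) = P.map (fun ω => (V ω, (-W) ω)) := by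
    rw [(indepFun_iff_map_prod_eq_prod_map_map hV.aemeasurable hW.aemeasurable).1 hVW,
      (indepFun_iff_map_prod_eq_prod_map_map hV.aemeasurable hW.neg.aemeasurable).1 hVW', hneg]
  let S : Set ((ℕ → ℝ) × ℝ) :=
    {p | (u < p.1 k ∧ ∀ j < k, p.1 j ≤ u) ∧ p.1 k + p.2 ≤ u}
  have hS : MeasurableSet S := by
    have h (j : ℕ) : Measurable fun p : (ℕ → ℝ) × ℝ => p.1 j :=
      (measurable_pi_apply j).comp measurable_fst
    refine MeasurableSet.inter (MeasurableSet.inter (measurableSet_lt measurable_const (h k)) ?_)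
      (measurableSet_le ((h k).add measurable_snd) measurable_const)
    have : {p : (ℕ → ℝ) × ℝ | ∀ j < k, p.1 j ≤ u} = ⋂ j, ⋂ (_ : j < k), {p | p.1 j ≤ u} := by
      ext; simp
    change MeasurableSet {p : (ℕ → ℝ) × ℝ | ∀ j < k, p.1 j ≤ u}
    rw [this]
    exact MeasurableSet.iInter fun j => MeasurableSet.iInter fun _ =>
      measurableSet_le (h j) measurable_const
  have := congrArg (fun μ => μ S) key
  rw [Measure.map_apply (hV.prodMk hW) hS, Measure.map_apply (hV.prodMk hW.neg) hS] at this
  convert this using 2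
  · ext ω
    simp +contextual [S, V, W, min_eq_left_of_lt]
  · ext ω
    simp +contextual [S, V, W, min_eq_left_of_lt]
    intro _ _
    constructor <;> intro <;> linarith

lemma measure_exists_le_lt [IsProbabilityMeasure P] {X : ℝ≥0 → Ω → ℝ}
    (hX : IsPreBrownianReal X P) (hm : ∀ t, Measurable (X t)) {s : ℕ → ℝ≥0} (hs : Monotone s)
    (n : ℕ) (u : ℝ) :
    P {ω | ∃ k ≤ n, u < X (s k) ω} = P {ω | u < X (s n) ω} +
      P {ω | ∃ k ≤ n, (u < X (s k) ω ∧ ∀ j < k, X (s j) ω ≤ u) ∧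
        2 * X (s k) ω - u ≤ X (s n) ω} := by
  classical
  let A : ℕ → Set Ω := fun k => {ω | u < X (s k) ω ∧ ∀ j < k, X (s j) ω ≤ u}
  have hA (k : ℕ) : MeasurableSet (A k) := by
    have : A k = {ω | u < X (s k) ω} ∩ ⋂ j, ⋂ (_ : j < k), {ω | X (s j) ω ≤ u} := by
      ext; simp [A]
    rw [this]
    exact (measurableSet_lt measurable_const (hm _)).inter <| MeasurableSet.iInter fun j =>
      MeasurableSet.iInter fun _ => measurableSet_le (hm _) measurable_const
  have hdisj : Pairwise (Function.onFun Disjoint A) := by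
    intro i j hij
    refine Set.disjoint_left.2 fun ω hi hj => ?_
    rcases hij.lt_or_gt with h | h
    · exact absurd hi.1 (not_lt.2 (hj.2 i h))
    · exact absurd hj.1 (not_lt.2 (hi.2 j h))
  have hL (D : ℕ → Set Ω) (hD : ∀ k, MeasurableSet (D k)) :
      P {ω | ∃ k ≤ n, ω ∈ A k ∧ ω ∈ D k} = ∑ k ∈ Finset.range (n + 1), P (A k ∩ D k) := by
    rw [← measure_biUnion_finset]
    · congr 1
      ext ω
      simp [and_left_comm]
    · intro i _ j _ hij
      exact (hdisj hij).mono inter_subset_left inter_subset_left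
    · exact fun k _ => (hA k).inter (hD k)
  have hle : MeasurableSet {ω | X (s n) ω ≤ u} := measurableSet_le (hm _) measurable_const
  have h1 : {ω | ∃ k ≤ n, u < X (s k) ω} ∩ {ω | X (s n) ω ≤ u} =
      {ω | ∃ k ≤ n, ω ∈ A k ∧ ω ∈ {ω | X (s n) ω ≤ u}} := by
    ext ω
    constructor
    · rintro ⟨⟨k, hk, hku⟩, h⟩
      have hex : ∃ k, u < X (s k) ω := ⟨k, hku⟩
      exact ⟨Nat.find hex, (Nat.find_min' hex hku).trans hk,
        ⟨Nat.find_spec hex, fun j hj => not_lt.1 (Nat.find_min hex hj)⟩, h⟩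
    · rintro ⟨k, hk, hA, h⟩
      exact ⟨⟨k, hk, hA.1⟩, h⟩
  have h2 : {ω | ∃ k ≤ n, u < X (s k) ω} \ {ω | X (s n) ω ≤ u} = {ω | u < X (s n) ω} := by
    ext ω
    simp only [Set.mem_sdiff, mem_ofPred_eq, not_le, and_iff_right_iff_imp]
    exact fun h => ⟨n, le_rfl, h⟩
  rw [← measure_inter_add_sdiff _ hle, h1, h2, hL _ fun _ => hle, add_comm]
  congr 1
  have := hL (fun k => {ω | 2 * X (s k) ω - u ≤ X (s n) ω})
    fun k => measurableSet_le (((hm _).const_mul 2).sub_const u) (hm _)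
  refine Eq.trans ?_ this.symm
  refine Finset.sum_congr rfl fun k hk => ?_
  exact measure_inter_reflect hX hm hs (hs (Nat.lt_succ_iff.1 (Finset.mem_range.1 hk))) u

lemma exists_le_lt_iff_exists_dense {f : ℝ≥0 → ℝ} (hf : Continuous f) {u : ℝ} (h0 : f 0 ≤ u)
    {d : ℕ → ℝ≥0} (hd : DenseRange d) (t : ℝ≥0) :
    (∃ s ≤ t, u < f s) ↔ ∃ m, d m < t ∧ u < f (d m) := by
  refine ⟨fun ⟨s, hst, hs⟩ => ?_, fun ⟨m, hm, h⟩ => ⟨_, hm.le, h⟩⟩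
  have ht : 0 < t := by
    refine pos_iff_ne_zero.2 fun h => ?_
    rw [h, nonpos_iff_eq_zero] at hst
    exact absurd hs (by rw [hst]; exact not_lt.2 h0)
  have ho : IsOpen {r | u < f r} := isOpen_lt continuous_const hf
  have hcl : s ∈ closure (Set.Iio t) := by
    rw [closure_Iio' (a := t) ⟨0, ht⟩]
    exact hst
  obtain ⟨m, hm⟩ := hd.exists_mem_open (ho.inter isOpen_Iio) (mem_closure_iff.1 hcl _ ho hs)
  exact ⟨m, hm.2, hm.1⟩

/-- The uniform grid of mesh `t / (n + 1)`. -/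
def uniformGrid (t : ℝ≥0) (n k : ℕ) : ℝ≥0 := t * k / (n + 1)

lemma uniformGrid_mono (t : ℝ≥0) (n : ℕ) : Monotone (uniformGrid t n) := fun i j hij => by
  unfold uniformGrid
  gcongr

@[simp] lemma uniformGrid_last (t : ℝ≥0) (n : ℕ) : uniformGrid t n (n + 1) = t := by
  have : (n : ℝ≥0) + 1 ≠ 0 := by positivity
  simp [uniformGrid, this]

@[simp] lemma uniformGrid_zero (t : ℝ≥0) (n : ℕ) : uniformGrid t n 0 = 0 := by
  simp [uniformGrid]

lemma uniformGrid_succ (t : ℝ≥0) (n k : ℕ) :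
    uniformGrid t n (k + 1) = uniformGrid t n k + t / (n + 1) := by
  simp [uniformGrid, mul_add, add_div]

lemma tendsto_uniformGrid_mesh (t : ℝ≥0) :
    Tendsto (fun n : ℕ => t / ((n : ℝ≥0) + 1)) atTop (𝓝 0) := by
  have h : Tendsto (fun n : ℕ => (t : ℝ) / ((n : ℝ) + 1)) atTop (𝓝 0) :=
    tendsto_const_nhds.div_atTop (tendsto_natCast_atTop_atTop.atTop_add tendsto_const_nhds)
  rw [← NNReal.tendsto_coe]
  simpa using h

lemma eventually_exists_uniformGrid_iff {f : ℝ≥0 → ℝ} (hf : Continuous f) (u : ℝ) (t : ℝ≥0) :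
    ∀ᶠ n in atTop, (∃ k ≤ n + 1, u < f (uniformGrid t n k)) ↔ ∃ s ≤ t, u < f s := by
  by_cases h : ∃ s ≤ t, u < f s
  · obtain ⟨s, hst, hs⟩ := h
    have key : Tendsto (fun n : ℕ => uniformGrid t n ⌊s / t * (n + 1)⌋₊) atTop (𝓝 s) := by
      rcases eq_or_ne t 0 with rfl | ht
      · simp [uniformGrid, nonpos_iff_eq_zero.1 hst]
      have hlow (n : ℕ) : s ≤ uniformGrid t n ⌊s / t * (n + 1)⌋₊ + t / (n + 1) := by
        rw [← uniformGrid_succ]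
        have hn : (0 : ℝ≥0) < n + 1 := by positivity
        rw [uniformGrid, le_div_iff₀ hn]
        have := (Nat.lt_floor_add_one (s / t * (n + 1))).le
        calc s * (n + 1) = t * (s / t * (n + 1)) := by field_simp
          _ ≤ _ := by
            push_cast
            gcongr
      have hup (n : ℕ) : uniformGrid t n ⌊s / t * (n + 1)⌋₊ ≤ s := by
        have hn : (0 : ℝ≥0) < n + 1 := by positivity
        rw [uniformGrid, div_le_iff₀ hn]
        calc _ ≤ t * (s / t * (n + 1)) := by
              gcongr
              exact Nat.floor_le (by positivity)
          _ = s * (n + 1) := by field_simp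
      have hlow' : Tendsto (fun n : ℕ => s - t / ((n : ℝ≥0) + 1)) atTop (𝓝 s) := by
        simpa using (tendsto_const_nhds (x := s)).sub (tendsto_uniformGrid_mesh t)
      exact tendsto_of_tendsto_of_tendsto_of_le_of_le hlow' tendsto_const_nhds
        (fun n => tsub_le_iff_right.2 (hlow n)) hup
    have := ((hf.tendsto s).comp key).eventually (lt_mem_nhds hs)
    filter_upwards [this] with n hn
    refine iff_of_true ⟨_, ?_, hn⟩ ⟨s, hst, hs⟩
    have : s / t * ((n : ℝ≥0) + 1) ≤ ((n + 1 : ℕ) : ℝ≥0) := by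
      push_cast
      exact mul_le_of_le_one_left (by positivity) (div_le_one_of_le₀ hst zero_le)
    exact (Nat.floor_le_floor this).trans (Nat.floor_natCast _).le
  · refine Eventually.of_forall fun n => iff_of_false ?_ h
    rintro ⟨k, hk, hu⟩
    exact h ⟨_, (uniformGrid_mono t n hk).trans (uniformGrid_last t n).le, hu⟩

lemma eventually_exists_reflected_iff {f : ℝ≥0 → ℝ} (hf : Continuous f) {u : ℝ} (h0 : f 0 ≤ u)
    (t : ℝ≥0) :
    ∀ᶠ n in atTop, (∃ k ≤ n + 1, (u < f (uniformGrid t n k) ∧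
        ∀ j < k, f (uniformGrid t n j) ≤ u) ∧ 2 * f (uniformGrid t n k) - u ≤ f t) ↔
      u < f t := by
  by_cases h : u < f t
  swap
  · refine Eventually.of_forall fun n => iff_of_false ?_ h
    rintro ⟨k, -, ⟨h1, -⟩, h2⟩
    linarith
  have huc : UniformContinuousOn f (Set.Icc 0 t) :=
    isCompact_Icc.uniformContinuousOn_of_continuous hf.continuousOn
  obtain ⟨δ, hδ, H⟩ := Metric.uniformContinuousOn_iff.1 huc ((f t - u) / 2) (by linarith)
  have hmesh := (tendsto_uniformGrid_mesh t).eventually (Metric.ball_mem_nhds _ hδ)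
  filter_upwards [hmesh] with n hn
  refine iff_of_true ?_ h
  have hex : ∃ k, u < f (uniformGrid t n k) := ⟨n + 1, by simpa using h⟩
  classical
  have hk : Nat.find hex ≤ n + 1 := Nat.find_min' hex (by simpa using h)
  have hlt := Nat.find_spec hex
  have hmin := fun j => Nat.find_min hex (m := j)
  generalize Nat.find hex = k at hk hlt hmin
  refine ⟨k, hk, ⟨hlt, fun j hj => not_lt.1 (hmin j hj)⟩, ?_⟩
  obtain _ | k := k
  · simp only [uniformGrid_zero] at hlt
    linarith
  have hle : uniformGrid t n (k + 1) ≤ t := (uniformGrid_mono t n hk).trans (uniformGrid_last t n).le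
  have := H _ ⟨zero_le, hle⟩ _ ⟨zero_le, (uniformGrid_mono t n k.le_succ).trans hle⟩ (by
    rw [uniformGrid_succ]
    simpa [NNReal.dist_eq] using hn)
  rw [Real.dist_eq] at this
  have h1 := (abs_lt.1 this).2
  have h2 := not_lt.1 (hmin k k.lt_succ_self)
  linarith

/-- **Reflection principle**, with the running supremum expressed through a dense sequence of
times. -/
lemma measure_exists_dense_lt [IsProbabilityMeasure P] {X : ℝ≥0 → Ω → ℝ}
    (hX : IsBrownianReal X P) (hm : ∀ t, Measurable (X t)) {d : ℕ → ℝ≥0} (hd : DenseRange d)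
    (t : ℝ≥0) {u : ℝ} (hu : 0 < u) :
    P {ω | ∃ m, d m < t ∧ u < X (d m) ω} = 2 * P {ω | u < X t ω} := by
  have hgt (s : ℝ≥0) : MeasurableSet {ω | u < X s ω} := measurableSet_lt measurable_const (hm s)
  have h1 : Tendsto (fun n : ℕ => P {ω | ∃ k ≤ n + 1, u < X (uniformGrid t n k) ω}) atTop
      (𝓝 (P {ω | ∃ m, d m < t ∧ u < X (d m) ω})) := by
    refine tendsto_measure_of_ae_tendsto_indicator_of_isFiniteMeasure _ ?_ (fun n => ?_) ?_
    · have : {ω | ∃ m, d m < t ∧ u < X (d m) ω} = ⋃ m, ⋃ (_ : d m < t), {ω | u < X (d m) ω} := by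
        ext; simp
      rw [this]
      exact MeasurableSet.iUnion fun m => MeasurableSet.iUnion fun _ => hgt _
    · have : {ω | ∃ k ≤ n + 1, u < X (uniformGrid t n k) ω} =
          ⋃ k, ⋃ (_ : k ≤ n + 1), {ω | u < X (uniformGrid t n k) ω} := by
        ext; simp
      rw [this]
      exact MeasurableSet.iUnion fun m => MeasurableSet.iUnion fun _ => hgt _
    · filter_upwards [hX.cont, hX.eval_zero_ae_eq_zero] with ω hc h0
      filter_upwards [eventually_exists_uniformGrid_iff hc u t] with n hn
      exact hn.trans (exists_le_lt_iff_exists_dense hc (h0.trans_le hu.le) hd t)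
  have h2 : Tendsto (fun n : ℕ => P {ω | ∃ k ≤ n + 1, (u < X (uniformGrid t n k) ω ∧
        ∀ j < k, X (uniformGrid t n j) ω ≤ u) ∧ 2 * X (uniformGrid t n k) ω - u ≤ X t ω}) atTop
      (𝓝 (P {ω | u < X t ω})) := by
    refine tendsto_measure_of_ae_tendsto_indicator_of_isFiniteMeasure _ (hgt t) (fun n => ?_) ?_
    · have : {ω | ∃ k ≤ n + 1, (u < X (uniformGrid t n k) ω ∧
            ∀ j < k, X (uniformGrid t n j) ω ≤ u) ∧ 2 * X (uniformGrid t n k) ω - u ≤ X t ω} =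
          ⋃ k, ⋃ (_ : k ≤ n + 1), ({ω | u < X (uniformGrid t n k) ω} ∩
            ⋂ j, ⋂ (_ : j < k), {ω | X (uniformGrid t n j) ω ≤ u}) ∩
            {ω | 2 * X (uniformGrid t n k) ω - u ≤ X t ω} := by
        ext; simp [and_assoc, and_left_comm]
      rw [this]
      exact MeasurableSet.iUnion fun k => MeasurableSet.iUnion fun _ =>
        ((hgt _).inter <| MeasurableSet.iInter fun j => MeasurableSet.iInter fun _ =>
          measurableSet_le (hm _) measurable_const).inter <|
          measurableSet_le (((hm _).const_mul 2).sub_const u) (hm t)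
    · filter_upwards [hX.cont, hX.eval_zero_ae_eq_zero] with ω hc h0
      exact eventually_exists_reflected_iff hc (h0.trans_le hu.le) t
  refine tendsto_nhds_unique h1 ?_
  rw [two_mul]
  refine (tendsto_const_nhds.add h2).congr fun n => ?_
  have := measure_exists_le_lt hX.toIsPreBrownianReal hm (uniformGrid_mono t n) (n + 1) u
  rw [uniformGrid_last] at this
  exact this.symm

lemma lt_sSup_image_Icc_iff {f : ℝ → ℝ} (hf : ContinuousOn f (Set.Ici 0)) {t : ℝ} (ht : 0 ≤ t)
    {u : ℝ} (h0 : f 0 ≤ u) {d : ℕ → ℝ≥0} (hd : DenseRange d) :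
    u < sSup (f '' Set.Icc 0 t) ↔ ∃ m, (d m : ℝ) < t ∧ u < f (d m) := by
  have hcont : Continuous fun s : ℝ≥0 => f s :=
    continuousOn_univ.1 (hf.comp NNReal.continuous_coe.continuousOn fun s _ => s.2)
  have hbdd : BddAbove (f '' Set.Icc 0 t) :=
    (isCompact_Icc.image_of_continuousOn (hf.mono fun _ h => h.1)).bddAbove
  rw [lt_csSup_iff hbdd ((Set.nonempty_Icc.2 ht).image f)]
  lift t to ℝ≥0 using ht
  have := exists_le_lt_iff_exists_dense hcont (by simpa using h0) hd t
  simp only [NNReal.coe_lt_coe]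
  rw [← this]
  constructor
  · rintro ⟨_, ⟨s, hs, rfl⟩, h⟩
    exact ⟨⟨s, hs.1⟩, hs.2, h⟩
  · rintro ⟨s, hs, h⟩
    exact ⟨f s, ⟨s, ⟨s.2, hs⟩, rfl⟩, h⟩

lemma gaussianReal_Ioi_eq (t : ℝ≥0) (u : ℝ) :
    gaussianReal 0 t (Set.Ioi u) = gaussianReal 0 1 {x | u < √t * x} := by
  have h := gaussianReal_map_const_mul (μ := 0) (v := 1) (√(t : ℝ))
  have : NNReal.mk (√(t : ℝ) ^ 2) (sq_nonneg _) * 1 = t := by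
    ext
    simp
  rw [mul_zero, this] at h
  rw [← h, Measure.map_apply (by fun_prop) measurableSet_Ioi]
  rfl

lemma lt_sqrt_mul_iff {u t x : ℝ} (hu : 0 < u) :
    u < √t * x ↔ 0 < x ∧ u ^ 2 / x ^ 2 < t := by
  rcases le_or_gt x 0 with hx | hx
  · refine iff_of_false ?_ fun h => absurd h.1 hx.not_gt
    have := mul_nonpos_of_nonneg_of_nonpos (Real.sqrt_nonneg t) hx
    linarith
  · rw [← div_lt_iff₀ hx, Real.lt_sqrt (by positivity), div_pow]
    simp [hx]

lemma measure_lt_sSup_eq_lintegral [IsProbabilityMeasure P] {B : ℝ → Ω → ℝ}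
    (hm : ∀ t, Measurable (B t)) (hX : IsPreBrownianReal (fun t : ℝ≥0 => B t) P)
    (hc : ∀ᵐ ω ∂P, ContinuousOn (fun t => B t ω) (Set.Ici 0))
    {T : Ω → ℝ} (hTm : Measurable T) (hT0 : ∀ ω, 0 ≤ T ω)
    (hInd : Indep (MeasurableSpace.comap T inferInstance)
      (⨆ t ∈ Set.Ici (0 : ℝ), MeasurableSpace.comap (B t) inferInstance) P)
    {u : ℝ} (hu : 0 < u) :
    P {ω | u < sSup ((fun s => B s ω) '' Set.Icc 0 (T ω))} =
      2 * ∫⁻ x, (Set.Ioi 0).indicator (fun x => P {ω | u ^ 2 / x ^ 2 < T ω}) x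
        ∂gaussianReal 0 1 := by
  have hB : IsBrownianReal (fun t : ℝ≥0 => B t) P :=
    ⟨hX, hc.mono fun ω h => continuousOn_univ.1
      (h.comp NNReal.continuous_coe.continuousOn fun s _ => s.2)⟩
  let d : ℕ → ℝ≥0 := TopologicalSpace.denseSeq ℝ≥0
  have hd : DenseRange d := TopologicalSpace.denseRange_denseSeq _
  let V : Ω → ℕ → ℝ := fun ω m => B (d m) ω
  have hV : Measurable V := measurable_pi_lambda _ fun _ => hm _
  have hTV : IndepFun T V P := by
    rw [IndepFun_iff_Indep]
    refine indep_of_indep_of_le_right hInd ?_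
    refine Measurable.comap_le ?_
    refine @measurable_pi_lambda _ _ _ (_) _ _ fun m => ?_
    exact (comap_measurable (B (d m))).mono
      (le_iSup₂_of_le (d m : ℝ) (d m).2 le_rfl) le_rfl
  let S : Set (ℝ × (ℕ → ℝ)) := {p | ∃ m, (d m : ℝ) < p.1 ∧ u < p.2 m}
  have hS : MeasurableSet S := by
    have : S = ⋃ m, {p | (d m : ℝ) < p.1 ∧ u < p.2 m} := by ext; simp [S]
    rw [this]
    exact MeasurableSet.iUnion fun m => (measurableSet_lt measurable_const measurable_fst).inter
      (measurableSet_lt measurable_const ((measurable_pi_apply m).comp measurable_snd))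
  have h1 : P {ω | u < sSup ((fun s => B s ω) '' Set.Icc 0 (T ω))} =
      P ((fun ω => (T ω, V ω)) ⁻¹' S) := by
    refine measure_congr ?_
    filter_upwards [hc, hX.eval_zero_ae_eq_zero] with ω hcω h0
    exact propext (lt_sSup_image_Icc_iff hcω (hT0 ω) (by simpa using h0.trans_le hu.le) hd)
  have h2 (ω : Ω) : P.map V (Prod.mk (T ω) ⁻¹' S) = 2 * gaussianReal 0 1 {x | u < √(T ω) * x} := by
    rw [Measure.map_apply hV (measurable_prodMk_left hS)]
    have h := measure_exists_dense_lt hB (fun t => hm _) hd ⟨T ω, hT0 ω⟩ hu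
    have h' := gaussianReal_Ioi_eq ⟨T ω, hT0 ω⟩ u
    have hl := (hX.hasLaw_eval ⟨T ω, hT0 ω⟩).map_eq
    rw [← hl, Measure.map_apply (hm _) measurableSet_Ioi] at h'
    exact h.trans (congrArg (2 * ·) h')
  have hR : MeasurableSet {p : Ω × ℝ | u < √(T p.1) * p.2} :=
    measurableSet_lt measurable_const ((hTm.comp measurable_fst).sqrt.mul measurable_snd)
  have hfub := Measure.prod_apply (μ := P) (ν := gaussianReal 0 1) hR
  have hfub' := Measure.prod_apply_symm (μ := P) (ν := gaussianReal 0 1) hR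
  rw [h1, ← Measure.map_apply (hTm.prodMk hV) hS,
    (indepFun_iff_map_prod_eq_prod_map_map hTm.aemeasurable hV.aemeasurable).1 hTV,
    Measure.prod_apply hS, lintegral_map (measurable_measure_prodMk_left hS) hTm]
  simp_rw [h2]
  have hmeas : Measurable fun ω => gaussianReal 0 1 {x | u < √(T ω) * x} :=
    measurable_measure_prodMk_left hR
  rw [lintegral_const_mul _ hmeas]
  congr 1
  refine hfub.symm.trans (hfub'.trans (lintegral_congr fun x => ?_))
  by_cases hx : x ∈ Set.Ioi (0 : ℝ)
  · rw [indicator_of_mem hx]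
    congr 1
    ext ω
    exact (lt_sqrt_mul_iff hu).trans (and_iff_right hx)
  · rw [indicator_of_notMem hx]
    convert measure_empty (μ := P)
    ext ω
    simpa using fun h => hx ((lt_sqrt_mul_iff hu).1 h).1

lemma toReal_measure_lt_sSup_eq_integral [IsProbabilityMeasure P] {B : ℝ → Ω → ℝ}
    (hm : ∀ t, Measurable (B t)) (hX : IsPreBrownianReal (fun t : ℝ≥0 => B t) P)
    (hc : ∀ᵐ ω ∂P, ContinuousOn (fun t => B t ω) (Set.Ici 0))
    {T : Ω → ℝ} (hTm : Measurable T) (hT0 : ∀ ω, 0 ≤ T ω)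
    (hInd : Indep (MeasurableSpace.comap T inferInstance)
      (⨆ t ∈ Set.Ici (0 : ℝ), MeasurableSpace.comap (B t) inferInstance) P)
    {u : ℝ} (hu : 0 < u) :
    (P {ω | u < sSup ((fun s => B s ω) '' Set.Icc 0 (T ω))}).toReal =
      2 / √(2 * Real.pi) * ∫ x, (Set.Ioi 0).indicator
        (fun x => Real.exp (-x ^ 2 / 2) * (P {ω | u ^ 2 / x ^ 2 < T ω}).toReal) x := by
  have hF : Antitone fun t : ℝ => P {ω | t < T ω} := fun s t hst =>
    measure_mono fun ω h => lt_of_le_of_lt hst h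
  have hmeas : Measurable ((Set.Ioi (0 : ℝ)).indicator fun x => P {ω | u ^ 2 / x ^ 2 < T ω}) :=
    (hF.measurable.comp (by fun_prop : Measurable fun x : ℝ => u ^ 2 / x ^ 2)).indicator
      measurableSet_Ioi
  rw [measure_lt_sSup_eq_lintegral hm hX hc hTm hT0 hInd hu, ENNReal.toReal_mul,
    ← integral_toReal hmeas.aemeasurable, integral_gaussianReal_eq_integral_smul one_ne_zero,
    ENNReal.toReal_ofNat, div_mul_eq_mul_div, mul_div_assoc, ← integral_div]
  · congr 2
    ext x
    by_cases hx : x ∈ Set.Ioi (0 : ℝ)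
    · simp [gaussianPDFReal, hx]
      ring
    · simp [hx]
  · refine ae_of_all _ fun x => ?_
    by_cases hx : x ∈ Set.Ioi (0 : ℝ)
    · simp [hx]
    · simp [hx]

/-- The rescaled exponent `(y² - 1) / 2 + (y ^ (-2α) - 1) / (2α)`, whose minimum over `y > 0` is
`0`, attained at `y = 1`. -/
def laplacePhase (α y : ℝ) : ℝ := (y ^ 2 - 1) / 2 + (y ^ (-2 * α) - 1) / (2 * α)

lemma sq_sub_one_le_laplacePhase {α y : ℝ} (hα : 0 < α) (hy : 0 < y) :
    (y - 1) ^ 2 / 2 ≤ laplacePhase α y := by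
  have h1 : 1 - 2 * α * (y - 1) ≤ y ^ (-2 * α) := by
    rw [Real.rpow_def_of_pos hy]
    have := Real.log_le_sub_one_of_pos hy
    have := Real.add_one_le_exp (Real.log y * (-2 * α))
    nlinarith
  have h2 : -(y - 1) ≤ (y ^ (-2 * α) - 1) / (2 * α) := by
    rw [le_div_iff₀ (by positivity)]
    linarith
  unfold laplacePhase
  linarith

lemma laplacePhase_nonneg {α y : ℝ} (hα : 0 < α) (hy : 0 < y) : 0 ≤ laplacePhase α y :=
  (by positivity : (0 : ℝ) ≤ (y - 1) ^ 2 / 2).trans (sq_sub_one_le_laplacePhase hα hy)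

lemma two_mul_abs_log_le_laplacePhase {α y : ℝ} (hα : 0 < α) (hy : 0 < y) (γ : ℝ) :
    |γ| * (2 * |Real.log y|) ≤ 4 * γ ^ 2 + 2 * γ ^ 2 / α + laplacePhase α y / 2 := by
  have h0 : 0 ≤ 2 * γ ^ 2 / α := by positivity
  have hlog := Real.log_le_sub_one_of_pos hy
  have hγ := sq_abs γ
  have hγ0 := abs_nonneg γ
  rcases le_total 1 y with h | h
  · have := sq_sub_one_le_laplacePhase hα hy
    rw [abs_of_nonneg (Real.log_nonneg h)]
    nlinarith [sq_nonneg (2 * |γ| - (y - 1) / 2), mul_le_mul_of_nonneg_left hlog hγ0]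
  · set w := -Real.log y with hw
    have hw0 : 0 ≤ w := neg_nonneg.2 (Real.log_nonpos hy.le h)
    have h1 : 2 * α * w + 2 * α ^ 2 * w ^ 2 ≤ y ^ (-2 * α) - 1 := by
      rw [Real.rpow_def_of_pos hy]
      have := Real.quadratic_le_exp_of_nonneg (x := 2 * α * w) (by positivity)
      have h' : Real.log y * (-2 * α) = 2 * α * w := by rw [hw]; ring
      rw [h']
      nlinarith
    have h2 : w + α * w ^ 2 ≤ (y ^ (-2 * α) - 1) / (2 * α) := by
      rw [le_div_iff₀ (by positivity)]
      linarith
    have h3 : α * w ^ 2 ≤ laplacePhase α y := by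
      unfold laplacePhase
      nlinarith [sq_nonneg (y - 1)]
    have h4 : 2 * (|γ| * w) ≤ 2 * γ ^ 2 / α + α * w ^ 2 / 2 := by
      have : 2 * γ ^ 2 / α + α * w ^ 2 / 2 - 2 * (|γ| * w) = (2 * |γ| - α * w) ^ 2 / (2 * α) := by
        field_simp
        rw [← hγ]
        ring
      have : 0 ≤ (2 * |γ| - α * w) ^ 2 / (2 * α) := by positivity
      linarith
    rw [abs_of_nonpos (Real.log_nonpos hy.le h), ← hw]
    nlinarith

lemma tendsto_laplacePhase_div_sq {α : ℝ} (hα : 0 < α) :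
    Tendsto (fun x => laplacePhase α (1 + x) / x ^ 2) (𝓝[≠] 0) (𝓝 (α + 1)) := by
  have hder {y : ℝ} (hy : 0 < y) :
      HasDerivAt (laplacePhase α) (y - y ^ (-2 * α - 1)) y := by
    have h := (((hasDerivAt_pow 2 y).sub_const 1).div_const 2).add
      (((Real.hasDerivAt_rpow_const (p := -2 * α) (Or.inl hy.ne')).sub_const 1).div_const (2 * α))
    refine HasDerivAt.congr_deriv (f := laplacePhase α) h ?_
    field_simp
    push_cast
    ring
  have hder2 : HasDerivAt (fun y : ℝ => y - y ^ (-2 * α - 1)) (2 * (α + 1)) 1 := by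
    have h := (hasDerivAt_id (1 : ℝ)).sub
      (Real.hasDerivAt_rpow_const (x := 1) (p := -2 * α - 1) (Or.inl one_ne_zero))
    refine HasDerivAt.congr_deriv h ?_
    simp
    ring
  have hslope := (hasDerivAt_iff_tendsto_slope_zero.1 hder2).div_const 2
  have hev : ∀ᶠ x : ℝ in 𝓝[≠] 0, 0 < 1 + x := by
    refine nhdsWithin_le_nhds ?_
    filter_upwards [lt_mem_nhds (show (-1 : ℝ) < 0 by norm_num)] with x hx
    linarith
  have hlim : Tendsto (fun x : ℝ => laplacePhase α (1 + x)) (𝓝[≠] 0) (𝓝 0) := by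
    have h := (hder one_pos).continuousAt.tendsto
    have h' : Tendsto (fun x : ℝ => 1 + x) (𝓝[≠] 0) (𝓝 1) := by
      refine Tendsto.mono_left ?_ nhdsWithin_le_nhds
      exact (by fun_prop : Continuous fun x : ℝ => 1 + x).tendsto' 0 1 (by simp)
    have := h.comp h'
    rwa [show laplacePhase α 1 = 0 by simp [laplacePhase]] at this
  refine HasDerivAt.lhopital_zero_nhdsNE
    (f' := fun x => (1 + x) - (1 + x) ^ (-2 * α - 1)) (g' := fun x => 2 * x) ?_ ?_ ?_ hlim ?_ ?_
  · filter_upwards [hev] with x hx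
    exact (hder hx).comp_const_add 1 x
  · refine Eventually.of_forall fun x => ?_
    simpa using hasDerivAt_pow 2 x
  · filter_upwards [self_mem_nhdsWithin] with x hx
    exact mul_ne_zero two_ne_zero hx
  · refine Tendsto.mono_left ?_ nhdsWithin_le_nhds
    exact (by fun_prop : Continuous fun x : ℝ => x ^ 2).tendsto' 0 0 (by simp)
  · have h2 : 2 * (α + 1) / 2 = α + 1 := by ring
    rw [h2] at hslope
    refine hslope.congr' ?_
    filter_upwards [self_mem_nhdsWithin] with x hx
    have hx' : x ≠ 0 := hx
    simp
    field_simp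

lemma tendsto_sq_mul_laplacePhase {α : ℝ} (hα : 0 < α) (z : ℝ) :
    Tendsto (fun r : ℝ => r ^ 2 * laplacePhase α ((z + r) / r)) atTop (𝓝 ((α + 1) * z ^ 2)) := by
  rcases eq_or_ne z 0 with rfl | hz
  · refine Tendsto.congr' ?_ (tendsto_const_nhds (x := (α + 1) * (0 : ℝ) ^ 2))
    filter_upwards [eventually_gt_atTop 0] with r hr
    simp [laplacePhase, hr.ne']
  · have h0 : Tendsto (fun r : ℝ => z / r) atTop (𝓝[≠] 0) := by
      refine tendsto_nhdsWithin_iff.2 ⟨tendsto_const_nhds.div_atTop tendsto_id, ?_⟩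
      filter_upwards [eventually_gt_atTop 0] with r hr
      exact div_ne_zero hz hr.ne'
    refine (((tendsto_laplacePhase_div_sq hα).comp h0).mul_const (z ^ 2)).congr' ?_
    filter_upwards [eventually_gt_atTop 0] with r hr
    have : (z + r) / r = 1 + z / r := by field_simp; ring
    rw [this]
    simp only [Function.comp_apply]
    field_simp

lemma rpow_max_one_div_le {t τ : ℝ} (ht : 0 < t) (hτ : 1 ≤ τ) (γ : ℝ) :
    (max t 1 / τ) ^ γ ≤ Real.exp (|γ| * |Real.log (t / τ)|) := by
  have hτ0 : 0 < τ := by linarith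
  have hm : 0 < max t 1 := lt_max_of_lt_right one_pos
  have hlog : |Real.log (max t 1 / τ)| ≤ |Real.log (t / τ)| := by
    rcases le_total 1 t with h | h
    · rw [max_eq_left h]
    · rw [max_eq_right h]
      have h1 : Real.log (1 / τ) ≤ 0 :=
        Real.log_nonpos (by positivity) (by rw [div_le_one hτ0]; exact hτ)
      have h2 : Real.log (t / τ) ≤ Real.log (1 / τ) :=
        Real.log_le_log (by positivity) (by gcongr)
      rw [abs_of_nonpos h1, abs_of_nonpos (h2.trans h1)]
      linarith
  rw [Real.rpow_def_of_pos (by positivity)]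
  refine Real.exp_le_exp.2 ?_
  calc _ ≤ |Real.log (max t 1 / τ) * γ| := le_abs_self _
    _ = |γ| * |Real.log (max t 1 / τ)| := by rw [abs_mul, mul_comm]
    _ ≤ _ := by gcongr

lemma exists_forall_le_of_weibull_tail {F : ℝ → ℝ} (hF1 : ∀ t, F t ≤ 1) {α β γ C : ℝ}
    (hα : 0 < α) (hβ : 0 < β) (hC : 0 < C)
    (hF : Tendsto (fun t => F t / (C * t ^ γ * Real.exp (-β * t ^ α))) atTop (𝓝 1)) :
    ∃ K, 0 ≤ K ∧ ∀ t > 0, F t ≤ K * (max t 1 ^ γ * Real.exp (-β * t ^ α)) := by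
  obtain ⟨t₁, h₁⟩ := eventually_atTop.1 (hF.eventually (gt_mem_nhds one_lt_two))
  set t₀ := max t₁ 1
  have ht₀ : 1 ≤ t₀ := le_max_right _ _
  set K₀ := Real.exp (|γ| * Real.log t₀) * Real.exp (β * t₀ ^ α) with hK₀def
  have hK₀ : 0 ≤ K₀ := by positivity
  refine ⟨2 * C + K₀, by positivity, fun t ht => ?_⟩
  rcases le_or_gt t₀ t with h | h
  · have h2 := h₁ t ((le_max_left _ _).trans h)
    rw [div_lt_iff₀ (by positivity)] at h2
    rw [max_eq_left (ht₀.trans h)]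
    have : 0 ≤ K₀ * (t ^ γ * Real.exp (-β * t ^ α)) := by positivity
    nlinarith
  · have hm : 1 ≤ max t 1 := le_max_right _ _
    have hm0 : 0 < max t 1 := by linarith
    have hm' : max t 1 ≤ t₀ := max_le h.le ht₀
    have hlog : Real.log (max t 1) ≤ Real.log t₀ := Real.log_le_log hm0 hm'
    have hlog0 : 0 ≤ Real.log (max t 1) := Real.log_nonneg hm
    have h1 : Real.exp (-(|γ| * Real.log t₀)) ≤ max t 1 ^ γ := by
      rw [Real.rpow_def_of_pos hm0]
      refine Real.exp_le_exp.2 ?_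
      have := neg_abs_le γ
      have := abs_nonneg γ
      nlinarith
    have h2 : Real.exp (-(β * t₀ ^ α)) ≤ Real.exp (-β * t ^ α) := by
      refine Real.exp_le_exp.2 ?_
      have := Real.rpow_le_rpow ht.le h.le hα.le
      nlinarith
    have h3 : 1 ≤ K₀ * (max t 1 ^ γ * Real.exp (-β * t ^ α)) := by
      calc (1 : ℝ) = K₀ * (Real.exp (-(|γ| * Real.log t₀)) * Real.exp (-(β * t₀ ^ α))) := by
            rw [hK₀def, ← Real.exp_add, ← Real.exp_add, ← Real.exp_add, eq_comm,
              Real.exp_eq_one_iff]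
            ring
        _ ≤ _ := by gcongr
    have h4 : 0 ≤ 2 * C * (max t 1 ^ γ * Real.exp (-β * t ^ α)) := by positivity
    linarith [hF1 t]

/-- The time at which the Weibull exponent balances a Gaussian level `r`. -/
def balanceTime (α β r : ℝ) : ℝ := (r ^ 2 / (2 * α * β)) ^ (1 / α)

lemma balanceTime_pos {α β r : ℝ} (hα : 0 < α) (hβ : 0 < β) (hr : 0 < r) :
    0 < balanceTime α β r := by
  unfold balanceTime
  positivity

lemma mul_balanceTime_rpow {α β r : ℝ} (hα : 0 < α) (hβ : 0 < β) :
    β * balanceTime α β r ^ α = r ^ 2 / (2 * α) := by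
  rw [balanceTime, ← Real.rpow_mul (by positivity), one_div_mul_cancel hα.ne', Real.rpow_one]
  field_simp

lemma tendsto_balanceTime {α β : ℝ} (hα : 0 < α) (hβ : 0 < β) :
    Tendsto (balanceTime α β) atTop atTop :=
  (tendsto_rpow_atTop (by positivity)).comp
    ((tendsto_pow_atTop two_ne_zero).atTop_div_const (by positivity))

/-- The Gaussian mixture integrand at level `r`, centred at its maximum and normalized. -/
def laplaceIntegrand (F : ℝ → ℝ) (α β γ r z : ℝ) : ℝ :=
  (Set.Ioi 0).indicator
    (fun x => Real.exp (-x ^ 2 / 2) * F (balanceTime α β r * r ^ 2 / x ^ 2)) (z + r) /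
    (balanceTime α β r ^ γ * Real.exp (-(r ^ 2 / 2) - r ^ 2 / (2 * α)))

lemma laplaceIntegrand_of_pos {F : ℝ → ℝ} {α β γ r z : ℝ} (hz : 0 < z + r) :
    laplaceIntegrand F α β γ r z =
      Real.exp (-(z + r) ^ 2 / 2) * F (balanceTime α β r * r ^ 2 / (z + r) ^ 2) /
        (balanceTime α β r ^ γ * Real.exp (-(r ^ 2 / 2) - r ^ 2 / (2 * α))) := by
  simp [laplaceIntegrand, hz]

lemma laplace_exponent_identity {α β r x : ℝ} (hα : 0 < α) (hβ : 0 < β) (hr : 0 < r)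
    (hx : 0 < x) :
    Real.exp (-x ^ 2 / 2) * Real.exp (-β * (balanceTime α β r * r ^ 2 / x ^ 2) ^ α) =
      Real.exp (-(r ^ 2 / 2) - r ^ 2 / (2 * α)) *
        Real.exp (-(r ^ 2 * laplacePhase α (x / r))) := by
  have hτ := balanceTime_pos hα hβ hr
  have h1 : (balanceTime α β r * r ^ 2 / x ^ 2) ^ α =
      balanceTime α β r ^ α * (x / r) ^ (-2 * α) := by
    have : balanceTime α β r * r ^ 2 / x ^ 2 = balanceTime α β r * (x / r) ^ (-2 : ℝ) := by
      rw [Real.rpow_neg (by positivity)]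
      norm_cast
      field_simp
    rw [this, Real.mul_rpow hτ.le (by positivity), ← Real.rpow_mul (by positivity)]
  rw [← Real.exp_add, ← Real.exp_add, h1, neg_mul, ← mul_assoc, mul_balanceTime_rpow hα hβ,
    laplacePhase]
  congr 1
  field_simp
  ring

lemma norm_laplaceIntegrand_le {F : ℝ → ℝ} (hF0 : ∀ t, 0 ≤ F t) {α β γ K : ℝ}
    (hα : 0 < α) (hβ : 0 < β) (hK : 0 ≤ K)
    (hF : ∀ t > 0, F t ≤ K * (max t 1 ^ γ * Real.exp (-β * t ^ α))) {r : ℝ} (hr : 1 ≤ r)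
    (hτ : 1 ≤ balanceTime α β r) (z : ℝ) :
    ‖laplaceIntegrand F α β γ r z‖ ≤
      K * Real.exp (4 * γ ^ 2 + 2 * γ ^ 2 / α) * Real.exp (-(1 / 4) * z ^ 2) := by
  rcases le_or_gt (z + r) 0 with hz | hz
  · have : laplaceIntegrand F α β γ r z = 0 := by
      simp [laplaceIntegrand, hz.not_gt]
    rw [this, norm_zero]
    positivity
  have hr0 : 0 < r := by linarith
  have hτ0 : 0 < balanceTime α β r := by linarith
  rw [laplaceIntegrand_of_pos hz, Real.norm_of_nonneg
    (div_nonneg (mul_nonneg (Real.exp_pos _).le (hF0 _)) (by positivity))]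
  set τ := balanceTime α β r with hτdef
  set x := z + r
  set t := τ * r ^ 2 / x ^ 2
  have ht : 0 < t := by positivity
  have hy : 0 < x / r := by positivity
  set p := laplacePhase α (x / r) with hp
  have hp0 : 0 ≤ p := laplacePhase_nonneg hα hy
  have hlog : |Real.log (t / τ)| = 2 * |Real.log (x / r)| := by
    have : t / τ = ((x / r) ^ 2)⁻¹ := by
      simp only [t]
      field_simp
    rw [this, Real.log_inv, Real.log_pow, abs_neg, abs_mul]
    simp
  have hrp : (max t 1 / τ) ^ γ ≤ Real.exp (4 * γ ^ 2 + 2 * γ ^ 2 / α + p / 2) := by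
    refine (rpow_max_one_div_le ht hτ γ).trans (Real.exp_le_exp.2 ?_)
    rw [hlog]
    exact two_mul_abs_log_le_laplacePhase hα hy γ
  have hsq : z ^ 2 / 2 ≤ r ^ 2 * p := by
    have := sq_sub_one_le_laplacePhase hα hy
    calc z ^ 2 / 2 = r ^ 2 * ((x / r - 1) ^ 2 / 2) := by
          simp only [x]; field_simp; ring
      _ ≤ r ^ 2 * p := by gcongr
  have hrp2 : p ≤ r ^ 2 * p := by nlinarith [mul_nonneg (sub_nonneg.2 hr) hp0]
  calc Real.exp (-x ^ 2 / 2) * F t / (τ ^ γ * Real.exp (-(r ^ 2 / 2) - r ^ 2 / (2 * α)))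
      ≤ Real.exp (-x ^ 2 / 2) * (K * (max t 1 ^ γ * Real.exp (-β * t ^ α))) /
          (τ ^ γ * Real.exp (-(r ^ 2 / 2) - r ^ 2 / (2 * α))) := by
        gcongr
        exact hF t ht
    _ = K * (max t 1 / τ) ^ γ * (Real.exp (-x ^ 2 / 2) * Real.exp (-β * t ^ α)) /
          Real.exp (-(r ^ 2 / 2) - r ^ 2 / (2 * α)) := by
        rw [Real.div_rpow (by positivity) hτ0.le]
        field_simp
    _ = K * (max t 1 / τ) ^ γ * Real.exp (-(r ^ 2 * p)) := by
        rw [laplace_exponent_identity hα hβ hr0 hz, ← hp]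
        field_simp
    _ ≤ K * Real.exp (4 * γ ^ 2 + 2 * γ ^ 2 / α + p / 2) * Real.exp (-(r ^ 2 * p)) := by
        gcongr
    _ = K * Real.exp (4 * γ ^ 2 + 2 * γ ^ 2 / α) * Real.exp (p / 2 - r ^ 2 * p) := by
        rw [mul_assoc, mul_assoc, ← Real.exp_add, ← Real.exp_add]
        congr 2
        ring
    _ ≤ _ := by
        gcongr
        linarith

lemma tendsto_laplaceIntegrand {F : ℝ → ℝ} {α β γ C : ℝ} (hα : 0 < α) (hβ : 0 < β) (hC : 0 < C)
    (hF : Tendsto (fun t => F t / (C * t ^ γ * Real.exp (-β * t ^ α))) atTop (𝓝 1)) (z : ℝ) :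
    Tendsto (fun r => laplaceIntegrand F α β γ r z) atTop
      (𝓝 (C * Real.exp (-(α + 1) * z ^ 2))) := by
  have hy : Tendsto (fun r : ℝ => r / (z + r)) atTop (𝓝 1) := by
    have h : Tendsto (fun r : ℝ => 1 - z / (z + r)) atTop (𝓝 (1 - 0)) :=
      tendsto_const_nhds.sub
        (tendsto_const_nhds.div_atTop (tendsto_const_nhds.add_atTop tendsto_id))
    rw [sub_zero] at h
    refine h.congr' ?_
    filter_upwards [eventually_gt_atTop (-z)] with r hr
    have : z + r ≠ 0 := by linarith
    field_simp
    ring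
  have hy2 : Tendsto (fun r : ℝ => (r / (z + r)) ^ 2) atTop (𝓝 1) := by
    simpa using hy.pow 2
  have hs : Tendsto (fun r => balanceTime α β r * r ^ 2 / (z + r) ^ 2) atTop atTop := by
    refine ((tendsto_balanceTime hα hβ).atTop_mul_pos one_pos hy2).congr fun r => ?_
    rw [div_pow, mul_div_assoc]
  have hpow : Tendsto (fun r : ℝ => ((r / (z + r)) ^ 2) ^ γ) atTop (𝓝 1) := by
    have := hy2.rpow_const (p := γ) (Or.inl one_ne_zero)
    simpa using this
  have hexp := (Real.continuous_exp.tendsto _).comp (tendsto_sq_mul_laplacePhase hα z).neg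
  have hmain := (((hF.comp hs).const_mul C).mul hpow).mul hexp
  rw [mul_one, mul_one, ← neg_mul] at hmain
  refine hmain.congr' ?_
  filter_upwards [eventually_gt_atTop (-z), eventually_gt_atTop 0] with r hr hr0
  have hx : 0 < z + r := by linarith
  have hτ := balanceTime_pos hα hβ hr0
  have hid := laplace_exponent_identity hα hβ hr0 hx
  rw [laplaceIntegrand_of_pos hx]
  have hs' : balanceTime α β r * r ^ 2 / (z + r) ^ 2 =
    balanceTime α β r * (r / (z + r)) ^ 2 := by
    rw [div_pow, mul_div_assoc]
  simp only [Function.comp_apply]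
  set E := Real.exp (-β * (balanceTime α β r * r ^ 2 / (z + r) ^ 2) ^ α)
  have hE : 0 < E := Real.exp_pos _
  set D := Real.exp (-(r ^ 2 / 2) - r ^ 2 / (2 * α))
  have hD : 0 < D := Real.exp_pos _
  have hq : Real.exp (-(r ^ 2 * laplacePhase α ((z + r) / r))) =
      Real.exp (-(z + r) ^ 2 / 2) * E / D := by
    rw [hid]
    field_simp
  have hs'' : (balanceTime α β r * r ^ 2 / (z + r) ^ 2) ^ γ =
      balanceTime α β r ^ γ * ((r / (z + r)) ^ 2) ^ γ := by
    rw [hs', Real.mul_rpow hτ.le (by positivity)]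
  rw [hq, hs'']
  have h3 : 0 < ((r / (z + r)) ^ 2) ^ γ := by positivity
  have h4 : 0 < balanceTime α β r ^ γ := by positivity
  generalize ((r / (z + r)) ^ 2) ^ γ = a at *
  generalize balanceTime α β r ^ γ = b at *
  field_simp

lemma tendsto_integral_laplaceIntegrand {F : ℝ → ℝ} (hFm : Measurable F) (hF0 : ∀ t, 0 ≤ F t)
    (hF1 : ∀ t, F t ≤ 1) {α β γ C : ℝ} (hα : 0 < α) (hβ : 0 < β) (hC : 0 < C)
    (hF : Tendsto (fun t => F t / (C * t ^ γ * Real.exp (-β * t ^ α))) atTop (𝓝 1)) :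
    Tendsto (fun r => ∫ z, laplaceIntegrand F α β γ r z) atTop
      (𝓝 (C * √(Real.pi / (α + 1)))) := by
  obtain ⟨K, hK, hbound⟩ := exists_forall_le_of_weibull_tail hF1 hα hβ hC hF
  rw [← integral_gaussian, ← integral_const_mul]
  refine tendsto_integral_filter_of_dominated_convergence
    (fun z => K * Real.exp (4 * γ ^ 2 + 2 * γ ^ 2 / α) * Real.exp (-(1 / 4) * z ^ 2)) ?_ ?_ ?_ ?_
  · refine Eventually.of_forall fun r => Measurable.aestronglyMeasurable ?_
    have h : Measurable fun x : ℝ =>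
        Real.exp (-x ^ 2 / 2) * F (balanceTime α β r * r ^ 2 / x ^ 2) :=
      Measurable.mul (by fun_prop) (hFm.comp (by fun_prop))
    exact ((h.indicator measurableSet_Ioi).comp (measurable_id.add_const r)).div_const _
  · filter_upwards [eventually_ge_atTop 1,
      (tendsto_balanceTime hα hβ).eventually (eventually_ge_atTop 1)] with r hr hτ
    exact ae_of_all _ fun z => norm_laplaceIntegrand_le hF0 hα hβ hK hbound hr hτ z
  · exact (integrable_exp_neg_mul_sq (by norm_num)).const_mul _
  · exact ae_of_all _ fun z => tendsto_laplaceIntegrand hα hβ hC hF z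

/-- The Gaussian level that dominates the event that the supremum exceeds `u`. -/
def gaussianLevel (α β u : ℝ) : ℝ :=
  (2 * α * β) ^ (1 / (2 * α + 2)) * u ^ (α / (α + 1))

lemma gaussianLevel_pos {α β u : ℝ} (hα : 0 < α) (hβ : 0 < β) (hu : 0 < u) :
    0 < gaussianLevel α β u := by
  unfold gaussianLevel
  positivity

lemma tendsto_gaussianLevel {α β : ℝ} (hα : 0 < α) (hβ : 0 < β) :
    Tendsto (gaussianLevel α β) atTop atTop :=
  (tendsto_rpow_atTop (by positivity)).const_mul_atTop (by positivity)

lemma gaussianLevel_sq {α β u : ℝ} (hα : 0 < α) (hβ : 0 < β) (hu : 0 < u) :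
    gaussianLevel α β u ^ 2 =
      Real.exp ((Real.log (2 * α * β) + 2 * α * Real.log u) / (α + 1)) := by
  rw [gaussianLevel, Real.rpow_def_of_pos (by positivity), Real.rpow_def_of_pos hu,
    ← Real.exp_add, ← Real.exp_nat_mul]
  congr 1
  field_simp
  push_cast
  ring

lemma balanceTime_gaussianLevel {α β u : ℝ} (hα : 0 < α) (hβ : 0 < β) (hu : 0 < u) :
    balanceTime α β (gaussianLevel α β u) =
      Real.exp ((2 * Real.log u - Real.log (2 * α * β)) / (α + 1)) := by
  have hk : 0 < 2 * α * β := by positivity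
  rw [balanceTime, gaussianLevel_sq hα hβ hu]
  nth_rw 2 [← Real.exp_log hk]
  rw [← Real.exp_sub, ← Real.exp_mul]
  congr 1
  field_simp
  ring

lemma balanceTime_gaussianLevel_mul_sq {α β u : ℝ} (hα : 0 < α) (hβ : 0 < β) (hu : 0 < u) :
    balanceTime α β (gaussianLevel α β u) * gaussianLevel α β u ^ 2 = u ^ 2 := by
  rw [balanceTime_gaussianLevel hα hβ hu, gaussianLevel_sq hα hβ hu, ← Real.exp_add]
  conv_rhs => rw [← Real.exp_log hu, ← Real.exp_nat_mul]
  congr 1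
  field_simp
  push_cast
  ring

lemma balanceTime_gaussianLevel_rpow {α β u : ℝ} (hα : 0 < α) (hβ : 0 < β) (hu : 0 < u)
    (γ : ℝ) :
    balanceTime α β (gaussianLevel α β u) ^ γ =
      (1 / 2 / (α * β)) ^ (γ / (α + 1)) * u ^ (2 * γ / (α + 1)) := by
  have hk : (1 / 2 / (α * β)) = (2 * α * β)⁻¹ := by field_simp
  rw [balanceTime_gaussianLevel hα hβ hu, hk, ← Real.exp_mul,
    Real.rpow_def_of_pos (by positivity), Real.rpow_def_of_pos hu, Real.log_inv, ← Real.exp_add]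
  congr 1
  field_simp
  ring

lemma gaussianLevel_exponent_eq {α β u : ℝ} (hα : 0 < α) (hβ : 0 < β) (hu : 0 < u) :
    gaussianLevel α β u ^ 2 / 2 + gaussianLevel α β u ^ 2 / (2 * α) =
      β ^ (1 / (1 + α)) * ((1 / 2) * (α / (1 / 2)) ^ (1 / (1 + α)) +
        (α / (1 / 2)) ^ (-α / (1 + α))) * u ^ (2 * α / (1 + α)) := by
  have h1 : α / (1 / 2) = 2 * α := by ring
  have h2 : (2 * α) ^ (-α / (1 + α)) = (2 * α) ^ (1 / (1 + α)) / (2 * α) := by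
    rw [← Real.rpow_sub_one (by positivity)]
    congr 1
    field_simp
    ring
  have h3 : gaussianLevel α β u ^ 2 =
      β ^ (1 / (1 + α)) * (2 * α) ^ (1 / (1 + α)) * u ^ (2 * α / (1 + α)) := by
    rw [gaussianLevel_sq hα hβ hu, Real.rpow_def_of_pos hβ, Real.rpow_def_of_pos (by positivity),
      Real.rpow_def_of_pos hu, ← Real.exp_add, ← Real.exp_add,
      Real.log_mul (by positivity) hβ.ne']
    congr 1
    field_simp
    ring
  rw [h1, h2, h3]
  ring

lemma integral_indicator_eq_mul_integral_laplaceIntegrand (F : ℝ → ℝ) {α β : ℝ} (hα : 0 < α)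
    (hβ : 0 < β) (γ : ℝ) {u : ℝ} (hu : 0 < u) :
    ∫ x, (Set.Ioi 0).indicator (fun x => Real.exp (-x ^ 2 / 2) * F (u ^ 2 / x ^ 2)) x =
      balanceTime α β (gaussianLevel α β u) ^ γ *
        Real.exp (-(gaussianLevel α β u ^ 2 / 2) - gaussianLevel α β u ^ 2 / (2 * α)) *
        ∫ z, laplaceIntegrand F α β γ (gaussianLevel α β u) z := by
  have hτ := balanceTime_pos hα hβ (gaussianLevel_pos hα hβ hu)
  simp only [laplaceIntegrand, integral_div, balanceTime_gaussianLevel_mul_sq hα hβ hu]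
  rw [integral_add_right_eq_self
    (fun x => (Set.Ioi 0).indicator (fun x => Real.exp (-x ^ 2 / 2) * F (u ^ 2 / x ^ 2)) x)]
  field_simp

lemma measurable_toReal_measure_lt [IsProbabilityMeasure P] (T : Ω → ℝ) :
    Measurable fun t => (P {ω | t < T ω}).toReal := by
  refine Antitone.measurable fun s t hst => ?_
  exact ENNReal.toReal_mono (measure_ne_top _ _)
    (measure_mono fun ω (hω : t < T ω) => hst.trans_lt hω)

end

/-- Theorem 4.1 (ii): for standard Brownian motion (fBm with `H = 1/2`) and an
independent Weibullian time `T`, the supremum `sup_{[0,T]} B_{1/2}` is asymptotically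
Weibullian (with the extra factor `2` in the constant). -/
theorem sup_fbm_weibullian_time_hurst_half {Ω : Type*} [MeasurableSpace Ω]
    (P : Measure Ω) [IsProbabilityMeasure P]
    (H : ℝ) (hH : H = (1 / 2 : ℝ))
    (B : ℝ → Ω → ℝ) (hB : IsFBM P H B)
    (T : Ω → ℝ) (hTm : Measurable T) (hTnn : ∀ ω, 0 ≤ T ω)
    (α β γ C : ℝ) (hα : 0 < α) (hβ : 0 < β) (hC : 0 < C)
    (hTW : MemW P T α β γ C)
    (hInd : Indep (MeasurableSpace.comap T inferInstance)
      (⨆ t ∈ Set.Ici (0 : ℝ), MeasurableSpace.comap (B t) inferInstance) P) :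
    MemW P (fun ω => sSup ((fun s => B s ω) '' Set.Icc 0 (T ω)))
      (2 * α / (2 * H + α))
      (β ^ (2 * H / (2 * H + α)) *
        ((1 / 2) * (α / H) ^ (2 * H / (2 * H + α)) + (α / H) ^ (-α / (2 * H + α))))
      (2 * γ / (α + 2 * H))
      (2 * (C * Real.sqrt H / Real.sqrt (α + 2 * H) *
        (H / (α * β)) ^ (γ / (α + 2 * H)))) := by
  subst hH
  have htwo : (2 : ℝ) * (1 / 2) = 1 := by norm_num
  have hJ := (tendsto_integral_laplaceIntegrand (measurable_toReal_measure_lt (P := P) T)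
    (fun _ => ENNReal.toReal_nonneg) (fun _ => ENNReal.toReal_mono ENNReal.one_ne_top prob_le_one)
    hα hβ hC hTW).comp (tendsto_gaussianLevel hα hβ)
  have hlim : C * √(Real.pi / (α + 1)) ≠ 0 := by positivity
  have hJ' := hJ.div_const (C * √(Real.pi / (α + 1)))
  rw [div_self hlim] at hJ'
  unfold MemW
  rw [htwo]
  refine hJ'.congr' ?_
  filter_upwards [eventually_gt_atTop 0] with u hu
  rw [toReal_measure_lt_sSup_eq_integral hB.1.1 hB.1.isPreBrownianReal hB.2.1 hTm hTnn hInd hu,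
    integral_indicator_eq_mul_integral_laplaceIntegrand
      (fun t => (P {ω | t < T ω}).toReal) hα hβ γ hu,
    balanceTime_gaussianLevel_rpow hα hβ hu, ← neg_add', gaussianLevel_exponent_eq hα hβ hu,
    ← neg_mul, Function.comp_apply]
  have hconst : 2 / √(2 * Real.pi) * (C * √(Real.pi / (α + 1))) =
      2 * (C * √(1 / 2) / √(α + 1)) := by
    rw [Real.sqrt_mul zero_le_two, Real.sqrt_div Real.pi_pos.le, Real.sqrt_div zero_le_one,
      Real.sqrt_one]
    have := Real.sqrt_pos.2 Real.pi_pos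
    field_simp
  rw [← mul_assoc 2, ← hconst]
  have h1 : 0 < (1 / 2 / (α * β)) ^ (γ / (α + 1)) := by positivity
  have h2 : 0 < u ^ (2 * γ / (α + 1)) := by positivity
  generalize (1 / 2 / (α * β)) ^ (γ / (α + 1)) = a at *
  generalize u ^ (2 * γ / (α + 1)) = b at *
  have h3 : 0 < √(Real.pi / (α + 1)) := by positivity
  have h4 : 0 < √(2 * Real.pi) := by positivity
  field_simp
end
end
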